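/- arXiv:2510.01572 — 4 statements merged into one kernel-verified Lean document; each statement's English description precedes it below -/
import Mathlib

section
/- For all integers n ≥ 0, a_5(5n + 3) ≡ 0 (mod 5). -/
/-- The set of `k`-colored-odd partitions of `n`: multisets of pairs `(m, c)` with
`m` a positive integer and `c ∈ {1, …, k}`, such that `c = 1` whenever `m` is even,
and the parts `m` sum (with multiplicity) to `n`. -/
def coloredOddPartitions (k n : ℕ) : Set (Multiset (ℕ × ℕ)) :=
  {s | (∀ p ∈ s, 0 < p.1 ∧ 1 ≤ p.2 ∧ p.2 ≤ k ∧ (Even p.1 → p.2 = 1)) ∧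
    (s.map Prod.fst).sum = n}

/-- `a k n` is the number of `k`-colored-odd partitions of `n`. -/
noncomputable def a (k n : ℕ) : ℕ := Nat.card (coloredOddPartitions k n)

open PowerSeries

namespace ColOdd

/-- triangular numbers -/
def T : ℕ → ℕ
  | 0 => 0
  | j + 1 => T j + (j + 1)

lemma two_T (j : ℕ) : 2 * T j = j * (j + 1) := by
  induction j with
  | zero => simp [T]
  | succ j ih => simp only [T]; nlinarith

lemma le_T (j : ℕ) : j ≤ T j := by
  cases j with
  | zero => simp
  | succ j => simp only [T]; omega

abbrev A := PowerSeries (ZMod 5)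

/-- the finite Euler product -/
noncomputable def P (n : ℕ) : A := ∏ k ∈ Finset.range n, (1 - X ^ (k + 1))

lemma P_succ (n : ℕ) : P (n + 1) = P n * (1 - X ^ (n + 1)) := by
  simp [P, Finset.prod_range_succ]

lemma P_zero : P 0 = 1 := by simp [P]

lemma isUnit_P (n : ℕ) : IsUnit (P n) := by
  rw [PowerSeries.isUnit_iff_constantCoeff]
  simp [P, map_prod]

lemma P_congr (k d : ℕ) : (X : A) ^ (k + 1) ∣ P (k + d) - P k := by
  induction d with
  | zero => simp
  | succ d ih =>
    have h : P (k + (d + 1)) - P k = (P (k + d) - P k) - P (k + d) * X ^ d * X ^ (k + 1) := by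
      rw [← add_assoc, P_succ]; ring
    rw [h]
    exact dvd_sub ih (Dvd.intro_left _ rfl)

/-- signed Gaussian binomials, by recursion -/
noncomputable def e : ℕ → ℕ → A
  | 0, 0 => 1
  | 0, _ + 1 => 0
  | n + 1, 0 => (1 + X ^ (2 * n + 2) + X ^ (n + 1)) * e n 0 - X ^ (n + 1) * e n 1
  | n + 1, j + 1 => (1 + X ^ (2 * n + 2)) * e n (j + 1) - X ^ (n + 1) * (e n j + e n (j + 2))

lemma e_zero_of_lt (n : ℕ) : ∀ j, n < j → e n j = 0 := by
  induction n with
  | zero =>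
    intro j hj
    obtain ⟨i, rfl⟩ : ∃ i, j = i + 1 := ⟨j - 1, by omega⟩
    simp [e]
  | succ n ih =>
    intro j hj
    obtain ⟨i, rfl⟩ : ∃ i, j = i + 1 := ⟨j - 1, by omega⟩
    simp [e, ih i (by omega), ih (i + 1) (by omega), ih (i + 2) (by omega)]

lemma sum_step (n K : ℕ) :
    ∑ j ∈ Finset.range (K + 1), (2 * (j : A) + 1) * e (n + 1) j =
      (1 - X ^ (n + 1)) ^ 2 * ∑ j ∈ Finset.range (K + 1), (2 * (j : A) + 1) * e n j
      + X ^ (n + 1) * (2 * (K : A) + 3) * e n K - X ^ (n + 1) * (2 * (K : A) + 1) * e n (K + 1) := by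
  induction K with
  | zero => simp [e]; ring
  | succ K ih =>
    rw [Finset.sum_range_succ, ih, Finset.sum_range_succ _ (K + 1)]
    simp only [e]
    push_cast
    ring

lemma sum_e (n : ℕ) : ∀ K, n ≤ K →
    ∑ j ∈ Finset.range (K + 1), (2 * (j : A) + 1) * e n j = P n ^ 2 := by
  induction n with
  | zero =>
    intro K _
    rw [Finset.sum_range_succ']
    simp [e, P_zero]
  | succ n ih =>
    intro K hK
    rw [sum_step, ih K (by omega), e_zero_of_lt n K (by omega), e_zero_of_lt n (K + 1) (by omega),
      P_succ]
    ring

lemma e_closed (n : ℕ) : ∀ j m, n = j + m →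
    e n j * P m * P (n + j + 1) = (-1) ^ j * X ^ T j * P (2 * n + 1) := by
  induction n with
  | zero =>
    intro j m h
    obtain rfl : j = 0 := by omega
    obtain rfl : m = 0 := by omega
    simp [e, T, P_zero]
  | succ n ih =>
    intro j m h
    have hR : P (2 * (n + 1) + 1) =
        P (2 * n + 1) * (1 - X ^ (2 * n + 2)) * (1 - X ^ (2 * n + 3)) := by
      rw [show 2 * (n + 1) + 1 = (2 * n + 1 + 1) + 1 by ring, P_succ, P_succ]
    cases j with
    | zero =>
      obtain rfl : m = n + 1 := by omega
      have h0 := ih 0 n (by omega)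
      have h1 : e n 1 * P (n + 1) * P (n + 2) =
          - X * P (2 * n + 1) * (1 - X ^ n) * (1 - X ^ (n + 1)) := by
        cases n with
        | zero => simp [e]
        | succ n =>
          have := ih 1 n (by omega)
          rw [P_succ (n + 1), P_succ n]
          simp only [T] at this
          linear_combination (1 - X ^ (n + 1)) * (1 - X ^ (n + 1 + 1)) * this
      rw [hR]
      simp only [T, e] at h0 ⊢
      have e2 : P (n + 1 + 0 + 1) = P (n + 0 + 1) * (1 - X ^ (n + 2)) := P_succ (n + 1)
      have e3 : P (n + 1 + 0 + 1) = P (n + 2) := rfl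
      rw [← e3] at h1
      have e1 := P_succ n
      rw [sub_mul, sub_mul]
      have : X ^ (n + 1) * e n 1 * P (n + 1) * P (n + 1 + 0 + 1) =
        X ^ (n + 1) * (- X * P (2 * n + 1) * (1 - X ^ n) * (1 - X ^ (n + 1))) := by
        rw [← h1]; ring
      rw [this, e2, mul_assoc _ (e n 0), show e n 0 * P (n + 1) = e n 0 * P n * (1 - X ^ (n + 1)) by rw [e1]; ring]
      linear_combination (1 + X ^ (2 * n + 2) + X ^ (n + 1)) * (1 - X ^ (n + 1))
        * (1 - X ^ (n + 2)) * h0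
    | succ j =>
      have hn : n = j + m := by omega
      have ha := ih j m hn
      have hb : e n (j + 1) * P m * P (n + j + 2) =
          (-1) ^ (j + 1) * X ^ T (j + 1) * P (2 * n + 1) * (1 - X ^ m) := by
        cases m with
        | zero => simp [e_zero_of_lt n (j + 1) (by omega)]
        | succ m =>
          have := ih (j + 1) m (by omega)
          rw [P_succ m]
          rw [show n + (j + 1) + 1 = n + j + 2 by ring] at this
          linear_combination (1 - X ^ (m + 1)) * this
      have hc : e n (j + 2) * P m * P (n + j + 3) =
          (-1) ^ (j + 2) * X ^ T (j + 2) * P (2 * n + 1) * (1 - X ^ m) * (1 - X ^ (m - 1)) := by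
        rcases m with _ | _ | m
        · simp [e_zero_of_lt n (j + 2) (by omega)]
        · simp [e_zero_of_lt n (j + 2) (by omega)]
        · have := ih (j + 2) m (by omega)
          rw [P_succ (m + 1), P_succ m]
          rw [show n + (j + 2) + 1 = n + j + 3 by ring] at this
          simp only [Nat.add_sub_cancel]
          linear_combination (1 - X ^ (m + 1)) * (1 - X ^ (m + 1 + 1)) * this
      have e3 : P (n + j + 3) = P (n + j + 2) * (1 - X ^ (n + j + 3)) := P_succ _
      have e2 : P (n + j + 2) = P (n + j + 1) * (1 - X ^ (n + j + 2)) := P_succ _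
      rw [hR, show n + 1 + (j + 1) + 1 = n + j + 3 by ring]
      have : e (n + 1) (j + 1) * P m * P (n + j + 3) =
          (1 + X ^ (2 * n + 2)) * (1 - X ^ (n + j + 3)) * (e n (j + 1) * P m * P (n + j + 2))
          - X ^ (n + 1) * ((1 - X ^ (n + j + 2)) * (1 - X ^ (n + j + 3)) *
            (e n j * P m * P (n + j + 1)) + e n (j + 2) * P m * P (n + j + 3)) := by
        simp only [e]
        rw [mul_add, e3, e2]; ring
      rw [this, ha, hb, hc]
      simp only [T]
      subst hn
      cases m with
      | zero => simp; ring
      | succ m => simp only [Nat.add_sub_cancel]; ring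

/-- Jacobi's identity, truncated -/
lemma e_limit (j m : ℕ) :
    (X : A) ^ (j + m + 1) ∣ e (j + m) j * P (j + m) - (-1) ^ j * X ^ T j := by
  have h := e_closed (j + m) j m rfl
  have hu : IsUnit (P m * P (j + m + j + 1)) := (isUnit_P _).mul (isUnit_P _)
  rw [← hu.dvd_mul_right]
  have h1 := P_congr m j
  have h2 := P_congr m (j + j + 1)
  have h3 := P_congr m (j + j + m + 1)
  rw [show m + j = j + m by ring] at h1
  rw [show m + (j + j + 1) = j + m + j + 1 by ring] at h2
  rw [show m + (j + j + m + 1) = 2 * (j + m) + 1 by ring] at h3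
  have h4 : (X : A) ^ (m + 1) ∣ P (2 * (j + m) + 1) * P (j + m) - P m * P (j + m + j + 1) := by
    have : P (2 * (j + m) + 1) * P (j + m) - P m * P (j + m + j + 1) =
      (P (2 * (j + m) + 1) - P m) * P (j + m) + P m * (P (j + m) - P m)
        - P m * (P (j + m + j + 1) - P m) := by ring
    rw [this]
    exact dvd_sub (dvd_add (h3.mul_right _) (h1.mul_left _)) (h2.mul_left _)
  have h5 : (e (j + m) j * P (j + m) - (-1) ^ j * X ^ T j) * (P m * P (j + m + j + 1)) =
      (-1) ^ j * (X ^ T j * (P (2 * (j + m) + 1) * P (j + m) - P m * P (j + m + j + 1))) := by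
    linear_combination P (j + m) * h
  rw [h5]
  apply Dvd.dvd.mul_left
  refine dvd_trans ?_ (mul_dvd_mul_left _ h4)
  rw [← pow_add]
  exact pow_dvd_pow _ (by have := le_T j; omega)

lemma jacobi (n : ℕ) : (X : A) ^ (n + 1) ∣
    P n ^ 3 - ∑ j ∈ Finset.range (n + 1), (2 * (j : A) + 1) * ((-1) ^ j * X ^ T j) := by
  rw [show P n ^ 3 = P n ^ 2 * P n by ring, ← sum_e n n le_rfl, Finset.sum_mul,
    ← Finset.sum_sub_distrib]
  refine Finset.dvd_sum fun j hj => ?_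
  obtain ⟨m, rfl⟩ := Nat.exists_eq_add_of_le (Nat.lt_succ_iff.1 (Finset.mem_range.1 hj))
  rw [mul_assoc, ← mul_sub]
  exact (e_limit j m).mul_left _

lemma coeff_jacobi (n v : ℕ) (hv : v ≤ n) (h : coeff v (P n ^ 3) ≠ 0) :
    ∃ j : ℕ, T j = v ∧ (2 * (j : ZMod 5) + 1) ≠ 0 := by
  have h1 := (PowerSeries.X_pow_dvd_iff.1 (jacobi n)) v (by omega)
  rw [map_sub, sub_eq_zero] at h1
  rw [h1, map_sum] at h
  obtain ⟨j, _, hj⟩ := Finset.exists_ne_zero_of_sum_ne_zero h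
  have : (2 * (j : A) + 1) * ((-1) ^ j * X ^ T j) =
      C ((2 * (j : ZMod 5) + 1) * (-1) ^ j) * X ^ T j := by
    have h2 : (C (2 : ZMod 5) : A) = 2 := map_ofNat _ 2
    simp [h2]; ring
  rw [this, coeff_C_mul, coeff_X_pow] at hj
  refine ⟨j, ?_, ?_⟩
  · by_contra hne
    exact hj (by rw [if_neg (fun h => hne h.symm), mul_zero])
  · intro h0
    exact hj (by rw [h0]; simp)

instance : Fact (Nat.Prime 5) := ⟨by norm_num⟩

lemma coeff_pent (n u : ℕ) (hu : u ≤ n) (h : coeff u (P n) ≠ 0) :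
    ∃ k : ℤ, pentagonal k = u := by
  have h1 := PowerSeries.coeff_prod_one_sub_X_pow_eventually_eq (ZMod 5) u
  have h2 := (Filter.tendsto_finset_range.eventually h1).and (Filter.eventually_ge_atTop n)
  obtain ⟨N, hN, hnN⟩ := h2.exists
  obtain ⟨d, rfl⟩ := Nat.exists_eq_add_of_le hnN
  have h3 := (PowerSeries.X_pow_dvd_iff.1 (P_congr n d)) u (by omega)
  rw [map_sub, sub_eq_zero] at h3
  have h4 : coeff u (pentagonalSeries (ZMod 5)) ≠ 0 := by
    rw [← hN]
    change coeff u (P (n + d)) ≠ 0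
    rwa [h3]
  rw [Ne, PowerSeries.coeff_pentagonalSeries_eq_zero_iff, not_not] at h4
  exact h4

lemma quad : ∀ x y : ZMod 5, x ^ 2 + 3 * y ^ 2 = 0 → y = 0 := by decide

lemma coeff_P4 (n M : ℕ) (hM : M ≤ n) (h4 : M % 5 = 4) : coeff M (P n ^ 4) = 0 := by
  rw [show P n ^ 4 = P n * P n ^ 3 by ring, coeff_mul]
  refine Finset.sum_eq_zero fun uv huv => ?_
  obtain ⟨u, v⟩ := uv
  have huv : u + v = M := by simpa using huv
  by_contra hne
  obtain ⟨k, hk⟩ := coeff_pent n u (by omega) (left_ne_zero_of_mul hne)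
  obtain ⟨j, hj, hj5⟩ := coeff_jacobi n v (by omega) (right_ne_zero_of_mul hne)
  apply hj5
  apply quad (6 * (k : ZMod 5) - 1)
  have a1 := two_mul_natCast_pentagonal k
  have a2 := two_T j
  rw [hk] at a1
  rw [hj] at a2
  have b1 : (2 * (u : ZMod 5)) = k * (3 * k - 1) := by exact_mod_cast congrArg (Int.cast (R := ZMod 5)) a1
  have b2 : (2 * (v : ZMod 5)) = j * (j + 1) := by exact_mod_cast congrArg (Nat.cast (R := ZMod 5)) a2
  have b3 : (u : ZMod 5) + v = 4 := by
    have : ((M : ℕ) : ZMod 5) = ((4 : ℕ) : ZMod 5) := by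
      rw [ZMod.natCast_eq_natCast_iff]; exact h4
    rw [← huv] at this
    exact_mod_cast this
  have b4 : (100 : ZMod 5) = 0 := by decide
  linear_combination (-12) * b1 - 12 * b2 + 24 * b3 + b4

/-! ### Counting multisets -/

section count
variable {ι : Type*} [DecidableEq ι] (w : ι → ℕ)

/-- multisets supported in `S` of weight `n` -/
def MS (S : Finset ι) (n : ℕ) : Set (Multiset ι) :=
  {s | (∀ p ∈ s, p ∈ S) ∧ (s.map w).sum = n}

lemma MS_insert_lt (S : Finset ι) (p : ι) (n : ℕ) (h : n < w p) :
    MS w (insert p S) n = MS w S n := by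
  ext s
  simp only [MS, Set.mem_ofPred_eq]
  constructor
  · rintro ⟨h1, h2⟩
    refine ⟨fun q hq => ?_, h2⟩
    rcases Finset.mem_insert.1 (h1 q hq) with rfl | h3
    · have := Multiset.single_le_sum (fun _ _ => Nat.zero_le _) _ (Multiset.mem_map_of_mem w hq)
      omega
    · exact h3
  · rintro ⟨h1, h2⟩
    exact ⟨fun q hq => Finset.mem_insert_of_mem (h1 q hq), h2⟩

lemma MS_insert_add (S : Finset ι) (p : ι) (n : ℕ) :
    MS w (insert p S) (n + w p) = MS w S (n + w p) ∪ Set.image (fun t => p ::ₘ t) (MS w (insert p S) n) := by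
  ext s
  simp only [MS, Set.mem_ofPred_eq, Set.mem_union, Set.mem_image]
  constructor
  · rintro ⟨h1, h2⟩
    by_cases hp : p ∈ s
    · right
      obtain ⟨t, rfl⟩ := Multiset.exists_cons_of_mem hp
      refine ⟨t, ⟨fun q hq => h1 q (Multiset.mem_cons_of_mem hq), ?_⟩, rfl⟩
      simp at h2
      omega
    · left
      refine ⟨fun q hq => ?_, h2⟩
      rcases Finset.mem_insert.1 (h1 q hq) with rfl | h3
      · exact absurd hq hp
      · exact h3
  · rintro (⟨h1, h2⟩ | ⟨t, ⟨h1, h2⟩, rfl⟩)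
    · exact ⟨fun q hq => Finset.mem_insert_of_mem (h1 q hq), h2⟩
    · refine ⟨fun q hq => ?_, by simp [h2, add_comm]⟩
      rcases Multiset.mem_cons.1 hq with rfl | h3
      · exact Finset.mem_insert_self _ _
      · exact h1 q h3

lemma MS_finite (S : Finset ι) (hw : ∀ p ∈ S, 0 < w p) : ∀ n, (MS w S n).Finite := by
  induction S using Finset.induction_on with
  | empty =>
    intro n
    refine (Set.finite_singleton (0 : Multiset ι)).subset ?_
    rintro s ⟨h, _⟩
    exact Multiset.eq_zero_of_forall_notMem fun q hq => by simpa using h q hq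
  | insert p S hp ih =>
    have ih := ih fun q hq => hw q (Finset.mem_insert_of_mem hq)
    have hp0 := hw p (Finset.mem_insert_self _ _)
    intro n
    induction n using Nat.strong_induction_on with
    | _ n ihn =>
      rcases lt_or_ge n (w p) with h | h
      · rw [MS_insert_lt w S p n h]; exact ih n
      · obtain ⟨m, rfl⟩ := Nat.exists_eq_add_of_le' h
        rw [MS_insert_add]
        exact (ih _).union ((ihn m (by omega)).image _)

lemma genfun (S : Finset ι) (hw : ∀ p ∈ S, 0 < w p) :
    (PowerSeries.mk fun n => ((MS w S n).ncard : ZMod 5)) * ∏ p ∈ S, (1 - (X : A) ^ w p) = 1 := by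
  induction S using Finset.induction_on with
  | empty =>
    ext n
    have : MS w ∅ n = if n = 0 then {0} else ∅ := by
      ext s
      constructor
      · rintro ⟨h1, h2⟩
        have : s = 0 := Multiset.eq_zero_of_forall_notMem fun q hq => by simpa using h1 q hq
        subst this
        simp at h2
        simp [← h2]
      · split_ifs with h
        · rintro rfl
          simp [MS, h]
        · simp
    simp only [Finset.prod_empty, mul_one, coeff_mk, this, coeff_one]
    split_ifs <;> simp
  | insert p S hp ih =>
    have hS : ∀ q ∈ S, 0 < w q := fun q hq => hw q (Finset.mem_insert_of_mem hq)
    rw [Finset.prod_insert hp, ← mul_assoc]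
    refine Eq.trans ?_ (ih hS)
    congr 1
    ext n
    clear ih
    rw [mul_sub, mul_one, map_sub, coeff_mul_X_pow', coeff_mk, coeff_mk]
    split_ifs with h
    · obtain ⟨m, rfl⟩ := Nat.exists_eq_add_of_le' h
      rw [MS_insert_add, Set.ncard_union_eq _ (MS_finite w S hS _)
        ((MS_finite w _ hw m).image _), Set.ncard_image_of_injective]
      · simp
      · intro s t; simp
      · rw [Set.disjoint_left]
        rintro s ⟨h1, _⟩ ⟨t, _, rfl⟩
        exact hp (h1 p (Multiset.mem_cons_self _ _))
    · rw [MS_insert_lt w S p n (by omega)]; simp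

end count

/-- admissible colored parts of size at most `2 * N` -/
def parts (N : ℕ) : Finset (ℕ × ℕ) :=
  (Finset.range N).biUnion fun m =>
    insert (2 * m + 2, 1) ((Finset.Icc 1 5).image fun c => (2 * m + 1, c))

lemma mem_parts (N : ℕ) (p : ℕ × ℕ) : p ∈ parts N ↔
    p.1 ≤ 2 * N ∧ 0 < p.1 ∧ 1 ≤ p.2 ∧ p.2 ≤ 5 ∧ (Even p.1 → p.2 = 1) := by
  obtain ⟨m, c⟩ := p
  simp only [parts, Finset.mem_biUnion, Finset.mem_range, Finset.mem_insert, Finset.mem_image,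
    Finset.mem_Icc, Prod.mk.injEq]
  constructor
  · rintro ⟨i, hi, ⟨rfl, rfl⟩ | ⟨d, hd, rfl, rfl⟩⟩
    · refine ⟨by omega, by omega, by omega, by omega, fun _ => rfl⟩
    · refine ⟨by omega, by omega, by omega, by omega, fun h => ?_⟩
      rw [Nat.even_iff] at h; omega
  · rintro ⟨h1, h2, h3, h4, h5⟩
    rcases Nat.even_or_odd' m with ⟨k, rfl | rfl⟩
    · exact ⟨k - 1, by omega, Or.inl ⟨by omega, h5 (by simp)⟩⟩
    · exact ⟨k, by omega, Or.inr ⟨c, ⟨h3, h4⟩, rfl, rfl⟩⟩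

lemma prod_parts (N : ℕ) : ∏ p ∈ parts N, (1 - (X : A) ^ p.1) =
    ∏ m ∈ Finset.range N, ((1 - X ^ (2 * m + 2)) * (1 - X ^ (2 * m + 1)) ^ 5) := by
  rw [parts, Finset.prod_biUnion]
  · refine Finset.prod_congr rfl fun m _ => ?_
    rw [Finset.prod_insert, Finset.prod_image]
    · simp
    · intro x _ y _ h; simpa using h
    · simp
  · intro x _ y _ hxy
    simp only [Function.onFun, Finset.disjoint_left]
    rintro ⟨m, c⟩ h1 h2
    simp only [Finset.mem_insert, Finset.mem_image, Prod.mk.injEq] at h1 h2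
    rcases h1 with h1 | ⟨_, _, h1, _⟩ <;> rcases h2 with h2 | ⟨_, _, h2, _⟩ <;> omega

lemma a_eq (N n : ℕ) (h : n ≤ 2 * N) : a 5 n = (MS Prod.fst (parts N) n).ncard := by
  unfold a
  rw [Nat.card_coe_set_eq]
  congr 1
  ext s
  simp only [coloredOddPartitions, MS, Set.mem_ofPred_eq, mem_parts]
  constructor
  · rintro ⟨h1, h2⟩
    refine ⟨fun p hp => ⟨?_, h1 p hp⟩, h2⟩
    have := Multiset.single_le_sum (fun _ _ => Nat.zero_le _) _
      (Multiset.mem_map_of_mem Prod.fst hp)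
    omega
  · rintro ⟨h1, h2⟩
    exact ⟨fun p hp => (h1 p hp).2, h2⟩

lemma pow5 (m : ℕ) : (1 - (X : A) ^ m) ^ 5 = 1 - X ^ (5 * m) := by
  have : CharP A 5 := charP_of_injective_ringHom (PowerSeries.C_injective (R := ZMod 5)) 5
  rw [sub_pow_char, one_pow, ← pow_mul, mul_comm]

lemma expand_P (p : ℕ) (hp : p ≠ 0) (n : ℕ) : expand p hp (P n) =
    ∏ k ∈ Finset.range n, (1 - X ^ (p * (k + 1))) := by
  simp [P, map_prod, pow_mul]

lemma key (N : ℕ) : (∏ p ∈ parts N, (1 - (X : A) ^ p.1)) * expand 2 two_ne_zero (P N ^ 4) =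
    expand 5 (by norm_num) (P (2 * N)) := by
  rw [prod_parts, map_pow, expand_P, expand_P, ← Finset.prod_pow, ← Finset.prod_mul_distrib]
  induction N with
  | zero => simp
  | succ N ih =>
    rw [Finset.prod_range_succ, ih, show 2 * (N + 1) = 2 * N + 1 + 1 by ring,
      Finset.prod_range_succ, Finset.prod_range_succ, ← pow5, ← pow5]
    ring

lemma main (N n : ℕ) (h : 5 * n + 3 ≤ 2 * N) : (a 5 (5 * n + 3) : ZMod 5) = 0 := by
  have hg := genfun Prod.fst (parts N) (fun p hp => ((mem_parts N p).1 hp).2.1)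
  have hk := key N
  obtain ⟨V, hV⟩ := (isUnit_P (2 * N)).exists_right_inv
  have hV' : expand 5 (by norm_num) (P (2 * N)) * expand 5 (by norm_num) V = 1 := by
    rw [← map_mul, hV, map_one]
  rw [a_eq N _ h]
  set G : A := PowerSeries.mk fun n => ((MS Prod.fst (parts N) n).ncard : ZMod 5) with hG
  have hGn : ((MS Prod.fst (parts N) (5 * n + 3)).ncard : ZMod 5) = coeff (5 * n + 3) G := by
    rw [hG, coeff_mk]
  have : G = expand 2 two_ne_zero (P N ^ 4) * expand 5 (by norm_num) V := by
    calc G = G * (expand 5 (by norm_num) (P (2 * N)) * expand 5 (by norm_num) V) := by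
            rw [hV', mul_one]
      _ = (G * ∏ p ∈ parts N, (1 - (X : A) ^ p.1)) *
          (expand 2 two_ne_zero (P N ^ 4) * expand 5 (by norm_num) V) := by rw [← hk]; ring
      _ = _ := by rw [hg, one_mul]
  rw [hGn, this, coeff_mul]
  refine Finset.sum_eq_zero fun uv huv => ?_
  obtain ⟨u, v⟩ := uv
  have huv : u + v = 5 * n + 3 := by simpa using huv
  by_cases h5 : 5 ∣ v
  · by_cases h2 : 2 ∣ u
    · obtain ⟨M, rfl⟩ := h2
      rw [coeff_expand_mul, coeff_P4 N M (by omega) (by omega), zero_mul]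
    · rw [coeff_expand_of_not_dvd _ _ _ h2, zero_mul]
  · rw [coeff_expand_of_not_dvd _ _ _ h5, mul_zero]

end ColOdd

theorem stmt0 (n : ℕ) : a 5 (5 * n + 3) ≡ 0 [MOD 5] := by
  rw [← ZMod.natCast_eq_natCast_iff, Nat.cast_zero]
  exact ColOdd.main (5 * n + 3) n (by omega)
end

section
/- For all integers α ≥ 0 and n ≥ 0, a_5(3^{2α+3} n + (153·3^{2α} − 1)/8) ≡ 0 (mod 3). (Note that 153·3^{2α} ≡ 1 (mod 8), so the indicated quotient is an integer.) -/
open PowerSeries Filter Topology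

theorem shanks_psi {R : Type*} [CommRing R] (q : R) (P Q : ℕ → R)
    (hPQ : ∀ n, P n * Q n = 1)
    (hP : ∀ n, P (n+1) * (1 - q^(2*n+1)) = P n * (1 - q^(2*n+2)))
    (hQ : ∀ n, Q (n+1) * (1 - q^(2*n+2)) = Q n * (1 - q^(2*n+1)))
    (hu : ∀ n, IsUnit (1 - q^(2*n+1))) (n : ℕ) :
    ∑ s ∈ Finset.range (n+1), P n * Q s * q^(s*(2*n+1))
      = ∑ s ∈ Finset.range (2*n+1), q^(s*(s+1)/2) := by
  induction n with
  | zero => simp [hPQ]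
  | succ n ih =>
    have e1 : (2*n+1)*(2*n+1+1)/2 = (n+1)*(2*n+1) := by
      rw [show (2*n+1)*(2*n+1+1) = ((n+1)*(2*n+1))*2 by ring]; simp
    have e2 : (2*n+1+1)*(2*n+1+1+1)/2 = (n+1)*(2*(n+1)+1) := by
      rw [show (2*n+1+1)*(2*n+1+1+1) = ((n+1)*(2*(n+1)+1))*2 by ring]; simp
    rw [show 2*(n+1)+1 = 2*n+1+1+1 by ring, Finset.sum_range_succ _ (2*n+1+1),
      Finset.sum_range_succ _ (2*n+1), ← ih, e1, e2]
    rw [Finset.sum_range_succ _ (n+1), hPQ, one_mul, show 2*n+1+1+1 = 2*(n+1)+1 by ring]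
    congr 1
    rw [← sub_eq_iff_eq_add', ← Finset.sum_sub_distrib]
    apply (hu n).mul_left_injective
    simp only [Finset.sum_mul]
    have key : ∀ s, (P (n+1) * Q s * q^(s*(2*(n+1)+1)) - P n * Q s * q^(s*(2*n+1))) * (1 - q^(2*n+1))
      = P n * Q (s+1) * q^((s+1)*(2*n+1)) * (1 - q^(2*(s+1)))
        - P n * Q s * q^(s*(2*n+1)) * (1 - q^(2*s)) := by
      intro s
      have h1 := hP n
      have h2 := hQ s
      have e : q^(s*(2*(n+1)+1)) = q^(s*(2*n+1)) * q^(2*s) := by rw [← pow_add]; ring_nf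
      have e' : q^((s+1)*(2*n+1)) = q^(s*(2*n+1)) * q^(2*n+1) := by rw [← pow_add]; ring_nf
      rw [e, e']
      have : 2*(s+1) = 2*s+2 := by ring
      rw [this]
      have e3 : q^(2*s+1) = q^(2*s) * q := by ring
      have e4 : q^(2*n+2) = q^(2*n+1) * q := by ring
      rw [e3] at h2; rw [e4] at h1
      linear_combination (Q s * q^(s*(2*n+1)) * q^(2*s)) * h1 - P n * q^(s*(2*n+1)) * q^(2*n+1) * h2
    rw [Finset.sum_congr rfl (fun s _ => key s), Finset.sum_range_sub (fun s => P n * Q s * q^(s*(2*n+1)) * (1 - q^(2*s)))]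
    have h2 := hQ n
    have h3 := hPQ n
    simp only [pow_zero, sub_self, mul_zero, sub_zero]
    rw [show 2*(n+1) = 2*n+2 by ring]
    linear_combination P n * q^((n+1)*(2*n+1)) * h2 + q^((n+1)*(2*n+1)) *(1 - q^(2*n+1)) * h3

theorem shanks_phi {R : Type*} [CommRing R] (q : R) (P Q c : ℕ → R)
    (hPQ : ∀ n, P n * Q n = 1)
    (hP : ∀ n, P (n+1) * (1 + q^(n+1)) = P n * (1 - q^(n+1)))
    (hQ : ∀ n, Q (n+1) * (1 - q^(n+1)) = Q n * (1 + q^(n+1)))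
    (hc0 : c 0 = 1) (hc : ∀ n, c n * (1 + q^n) = 2)
    (hu : ∀ n, IsUnit (1 + q^(n+1))) (n : ℕ) :
    ∑ s ∈ Finset.range (n+1), (-1)^s * c s * P n * Q s * q^(s*(n+1))
      = 1 + 2 * ∑ s ∈ Finset.range n, (-1)^(s+1) * q^((s+1)^2) := by
  induction n with
  | zero => simp [hPQ, hc0]
  | succ n ih =>
    rw [Finset.sum_range_succ _ n, mul_add, ← add_assoc, ← ih]
    rw [Finset.sum_range_succ _ (n+1), ← sub_eq_iff_eq_add', add_sub_right_comm, ← Finset.sum_sub_distrib]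
    apply (hu n).mul_left_injective
    simp only []
    rw [add_mul, Finset.sum_mul]
    have key : ∀ s, ((-1)^s * c s * P (n+1) * Q s * q^(s*(n+1+1)) - (-1)^s * c s * P n * Q s * q^(s*(n+1))) * (1 + q^(n+1))
      = (-1)^(s+1) * c (s+1) * P n * Q (s+1) * q^((s+1)*(n+1)) * (1 - q^(s+1))
        - (-1)^s * c s * P n * Q s * q^(s*(n+1)) * (1 - q^s) := by
      intro s
      have h1 := hP n
      have h2 := hQ s
      have h3 := hc s
      have h4 := hc (s+1)
      have e : q^(s*(n+1+1)) = q^(s*(n+1)) * q^s := by rw [← pow_add]; ring_nf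
      have e' : q^((s+1)*(n+1)) = q^(s*(n+1)) * q^(n+1) := by rw [← pow_add]; ring_nf
      rw [e, e', pow_succ (-1 : R) s]
      linear_combination ((-1)^s * c s * Q s * q^(s*(n+1)) * q^s) * h1
        + (-1)^s * c (s+1) * P n * q^(s*(n+1)) * q^(n+1) * h2
        + (-1)^s * P n * Q s * q^(s*(n+1)) * q^(n+1) * (h4 - h3)
    rw [Finset.sum_congr rfl (fun s _ => key s), Finset.sum_range_sub (fun s => (-1)^s * c s * P n * Q s * q^(s*(n+1)) * (1 - q^s))]
    have h2 := hQ n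
    have h3 := hPQ n
    have h5 := hPQ (n+1)
    have h4 := hc (n+1)
    simp only [pow_zero, sub_self, mul_zero, sub_zero]
    have e : q^((n+1)*(n+1+1)) = q^((n+1)^2) * q^(n+1) := by rw [← pow_add]; ring_nf
    have e' : q^((n+1)*(n+1)) = q^((n+1)^2) := by ring_nf
    rw [e, e']
    linear_combination (-1)^(n+1) * c (n+1) * P n * q^((n+1)^2) * h2
      + (-1)^(n+1) * c (n+1) * (1+q^(n+1)) * q^((n+1)^2) * h3
      + (-1)^(n+1) * c (n+1) * (1+q^(n+1)) * q^((n+1)^2) * q^(n+1) * h5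
      + (-1)^(n+1) * q^((n+1)^2) * (1 + q^(n+1)) * h4

/-- multisets with elements in `T` and weight `n` -/
def msT (T : Finset (ℕ × ℕ)) (n : ℕ) : Set (Multiset (ℕ × ℕ)) :=
  {s | (∀ p ∈ s, p ∈ T) ∧ (s.map Prod.fst).sum = n}

theorem msT_empty (n : ℕ) : msT ∅ n = if n = 0 then {0} else ∅ := by
  ext s
  simp only [msT, Finset.notMem_empty, Set.mem_ofPred_eq]
  constructor
  · rintro ⟨h, h2⟩
    obtain rfl := Multiset.eq_zero_of_forall_notMem h
    simp at h2
    simp [← h2]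
  · split_ifs with h
    · rintro rfl; simp [h]
    · simp

theorem msT_insert (T : Finset (ℕ × ℕ)) (t : ℕ × ℕ) (n : ℕ) :
    msT (insert t T) n = msT T n ∪
      (if t.1 ≤ n then (Multiset.cons t) '' msT (insert t T) (n - t.1) else ∅) := by
  ext s
  constructor
  · rintro ⟨h, h2⟩
    by_cases ht : t ∈ s
    · right
      obtain ⟨s', rfl⟩ := Multiset.exists_cons_of_mem ht
      simp only [Multiset.map_cons, Multiset.sum_cons] at h2
      rw [if_pos (by omega)]
      refine ⟨s', ⟨fun p hp => h p (Multiset.mem_cons_of_mem hp), by omega⟩, rfl⟩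
    · left
      refine ⟨fun p hp => ?_, h2⟩
      rcases Finset.mem_insert.1 (h p hp) with rfl | h'
      · exact absurd hp ht
      · exact h'
  · rintro (⟨h, h2⟩ | h)
    · exact ⟨fun p hp => Finset.mem_insert_of_mem (h p hp), h2⟩
    · split_ifs at h with h0
      · obtain ⟨s', ⟨h, h2⟩, rfl⟩ := h
        refine ⟨fun p hp => ?_, ?_⟩
        · rcases Multiset.mem_cons.1 hp with rfl | h'
          · exact Finset.mem_insert_self _ _
          · exact h p h'
        · simp only [Multiset.map_cons, Multiset.sum_cons]; omega
      · exact absurd h (Set.notMem_empty _)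

theorem msT_finite (T : Finset (ℕ × ℕ)) (hT : ∀ t ∈ T, 0 < t.1) (n : ℕ) : (msT T n).Finite := by
  induction T using Finset.induction_on generalizing n with
  | empty => rw [msT_empty]; split_ifs <;> simp
  | insert t T ht ih =>
    have ih := ih (fun x hx => hT x (Finset.mem_insert_of_mem hx))
    have h0 := hT t (Finset.mem_insert_self _ _)
    induction n using Nat.strong_induction_on with
    | _ n ihn =>
      rw [msT_insert]
      refine (ih n).union ?_
      split_ifs with h
      · exact (ihn _ (by omega)).image _
      · exact Set.finite_empty

theorem msT_ncard_insert (T : Finset (ℕ × ℕ)) (hT : ∀ t ∈ T, 0 < t.1) (t : ℕ × ℕ) (ht : t ∉ T)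
    (h0 : 0 < t.1) (n : ℕ) :
    (msT (insert t T) n).ncard = (msT T n).ncard +
      (if t.1 ≤ n then (msT (insert t T) (n - t.1)).ncard else 0) := by
  have hT' : ∀ x ∈ insert t T, 0 < x.1 := by
    intro x hx
    rcases Finset.mem_insert.1 hx with rfl | h
    · exact h0
    · exact hT x h
  rw [msT_insert, Set.ncard_union_eq ?_ (msT_finite T hT n) ?_]
  · split_ifs with h
    · rw [Set.ncard_image_of_injective]
      intro a b hab
      exact (Multiset.cons_inj_right t).1 hab
    · simp
  · rw [Set.disjoint_left]
    rintro s ⟨h1, _⟩ h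
    split_ifs at h
    · obtain ⟨s', _, rfl⟩ := h
      exact ht (h1 t (Multiset.mem_cons_self _ _))
    · exact h
  · split_ifs with h
    · exact (msT_finite _ hT' _).image _
    · exact Set.finite_empty

theorem msT_gen (R : Type*) [CommRing R] (T : Finset (ℕ × ℕ)) (hT : ∀ t ∈ T, 0 < t.1) :
    (PowerSeries.mk fun n => ((msT T n).ncard : R)) * ∏ t ∈ T, (1 - X ^ t.1) = 1 := by
  induction T using Finset.induction_on with
  | empty =>
    ext n
    simp only [msT_empty, Finset.prod_empty, mul_one, coeff_mk, coeff_one]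
    split_ifs <;> simp
  | insert t T ht ih =>
    have hT' := (fun x hx => hT x (Finset.mem_insert_of_mem hx))
    have ih := ih hT'
    have h0 := hT t (Finset.mem_insert_self _ _)
    rw [Finset.prod_insert ht, ← mul_assoc]
    have : (PowerSeries.mk fun n => ((msT (insert t T) n).ncard : R)) * (1 - X ^ t.1)
      = PowerSeries.mk fun n => ((msT T n).ncard : R) := by
      ext n
      rw [mul_sub, mul_one, map_sub, coeff_mul_X_pow', coeff_mk, coeff_mk, msT_ncard_insert T hT' t ht h0 n]
      split_ifs <;> simp
    rw [this, ih]
/-- allowed parts of size at most `2N` -/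
def Tset (N : ℕ) : Finset (ℕ × ℕ) :=
  (Finset.range N ×ˢ Finset.range 5).image (fun p => (2 * p.1 + 1, p.2 + 1)) ∪
  (Finset.range N).image (fun i => (2 * i + 2, 1))

theorem Tset_prod (R : Type*) [CommRing R] (N : ℕ) :
    ∏ t ∈ Tset N, (1 - (X : R⟦X⟧) ^ t.1) =
    (∏ i ∈ Finset.range N, (1 - (X : R⟦X⟧) ^ (2 * i + 1))) ^ 5 *
      ∏ i ∈ Finset.range N, (1 - (X : R⟦X⟧) ^ (2 * i + 2)) := by
  rw [Tset, Finset.prod_union, Finset.prod_image, Finset.prod_image, Finset.prod_product]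
  · simp [Finset.prod_pow]
  · intro x _ y _ h; simp at h; exact h
  · rintro ⟨x, x'⟩ _ ⟨y, y'⟩ _ h; simp at h; simp; omega
  · rw [Finset.disjoint_left]
    intro p hp hp'
    simp only [Finset.mem_image] at hp hp'
    obtain ⟨x, _, rfl⟩ := hp
    obtain ⟨y, _, h⟩ := hp'
    simp at h
    omega

theorem Tset_pos (N : ℕ) : ∀ t ∈ Tset N, 0 < t.1 := by
  intro t ht
  simp only [Tset, Finset.mem_union, Finset.mem_image] at ht
  obtain ⟨x, _, rfl⟩ | ⟨x, _, rfl⟩ := ht <;> simp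

theorem a_eq_msT (N n : ℕ) (h : n ≤ N) : a 5 n = (msT (Tset N) n).ncard := by
  rw [a, Nat.card_coe_set_eq]
  congr 1
  ext s
  simp only [coloredOddPartitions, msT, Set.mem_ofPred_eq]
  refine and_congr_left fun hs => forall₂_congr fun p hp => ?_
  have hle : p.1 ≤ n := by
    rw [← hs]
    exact Multiset.single_le_sum (by simp) _ (Multiset.mem_map_of_mem _ hp)
  obtain ⟨m, c⟩ := p
  simp only [Tset, Finset.mem_union, Finset.mem_image, Finset.mem_product, Finset.mem_range,
    Prod.exists, Prod.mk.injEq]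
  simp only at hle
  constructor
  · rintro ⟨h1, h2, h3, h4⟩
    rcases Nat.even_or_odd' m with ⟨i, rfl | rfl⟩
    · right; exact ⟨i - 1, by omega, by omega, (h4 (by simp)).symm⟩
    · left; exact ⟨i, c - 1, by omega, by omega, by omega⟩
  · rintro (⟨i, j, h1, h2, h3⟩ | ⟨i, h1, h2, h3⟩)
    · refine ⟨by omega, by omega, by omega, fun he => ?_⟩
      rw [Nat.even_iff] at he; omega
    · refine ⟨by omega, by omega, by omega, fun he => h3.symm⟩

/-- integer square roots of `n` -/
noncomputable def sqz (n : ℕ) : Finset ℤ := (Finset.Icc (-n : ℤ) n).filter (fun y => y ^ 2 = n)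

theorem mem_sqz (n : ℕ) (y : ℤ) : y ∈ sqz n ↔ y ^ 2 = n := by
  simp only [sqz, Finset.mem_filter, Finset.mem_Icc, and_iff_right_iff_imp]
  intro h
  constructor <;> nlinarith

theorem sqz_sq (m : ℕ) : sqz (m ^ 2) = {(m : ℤ), -(m : ℤ)} := by
  ext y
  rw [mem_sqz]
  simp [sq_eq_sq_iff_eq_or_eq_neg]

theorem sqz_nonsq (n : ℕ) (h : ∀ m : ℕ, m ^ 2 ≠ n) : sqz n = ∅ := by
  ext y
  rw [mem_sqz]
  simp only [Finset.notMem_empty, iff_false]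
  intro hy
  apply h y.natAbs
  zify
  simpa using hy

/-- `∑ (-1)^y q^(y^2)` -/
noncomputable def phi : (ZMod 3)⟦X⟧ :=
  PowerSeries.mk fun n => ∑ y ∈ sqz n, (-1) ^ y.natAbs
/-- `∑ q^((x^2-1)/8)` over odd integers `x` -/
noncomputable def psi : (ZMod 3)⟦X⟧ :=
  PowerSeries.mk fun n => ((sqz (8 * n + 1)).card : ZMod 3)

open scoped PowerSeries.WithPiTopology

theorem tendsto_of_eventually_coeff (f : ℕ → (ZMod 3)⟦X⟧) (g : (ZMod 3)⟦X⟧)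
    (h : ∀ d n, d ≤ n → coeff d (f n) = coeff d g) : Tendsto f atTop (𝓝 g) := by
  rw [WithPiTopology.tendsto_iff_coeff_tendsto]
  intro d
  apply tendsto_nhds_of_eventually_eq
  exact eventually_atTop.2 ⟨d, fun n hn => h d n hn⟩

theorem phi_lim : Tendsto (fun n => (1 : (ZMod 3)⟦X⟧) +
    2 * ∑ s ∈ Finset.range n, (-1)^(s+1) * X^((s+1)^2)) atTop (𝓝 phi) := by
  apply tendsto_of_eventually_coeff
  intro d n hd
  have e : ∀ s : ℕ, ((-1)^(s+1) * X^((s+1)^2) : (ZMod 3)⟦X⟧) = C ((-1)^(s+1)) * X^((s+1)^2) := by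
    intro s; simp
  have e2 : (2 : (ZMod 3)⟦X⟧) = C 2 := (map_ofNat C 2).symm
  simp only [e, e2, map_add, coeff_C_mul, map_sum, coeff_X_pow, coeff_one, phi, coeff_mk]
  by_cases h : ∃ m : ℕ, m ^ 2 = d
  · obtain ⟨m, rfl⟩ := h
    rw [sqz_sq]
    rcases m with _ | m
    · rw [Finset.sum_eq_zero]
      · simp
      · intro s _
        rw [if_neg (by positivity), mul_zero]
    · rw [Finset.sum_eq_single m]
      · rw [Finset.sum_pair]
        · rw [if_neg (by positivity)]
          simp only [Int.natAbs_neg, Int.natAbs_natCast]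
          simp
          ring
        · intro h
          omega
      · intro b _ hb
        rw [if_neg, mul_zero]
        intro h
        have := Nat.pow_left_injective (by norm_num : (2:ℕ) ≠ 0) h
        omega
      · intro h
        simp at h
        nlinarith
  · push Not at h
    rw [sqz_nonsq d h, if_neg (fun h' => h 0 (by simp [h'])), Finset.sum_eq_zero]
    · simp
    · intro s _
      rw [if_neg (fun h' => h (s+1) h'.symm), mul_zero]

theorem tri_iff (s d : ℕ) : d = s * (s + 1) / 2 ↔ (2 * s + 1) ^ 2 = 8 * d + 1 := by
  obtain ⟨k, hk⟩ := Nat.even_mul_succ_self s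
  rw [hk]
  have : (2 * s + 1) ^ 2 = 4 * (s * (s + 1)) + 1 := by ring
  rw [this, hk]
  omega

theorem psi_lim : Tendsto (fun n => (2 : (ZMod 3)⟦X⟧) *
    ∑ s ∈ Finset.range (2 * n + 1), X^(s*(s+1)/2)) atTop (𝓝 psi) := by
  apply tendsto_of_eventually_coeff
  intro d n hd
  have e2 : (2 : (ZMod 3)⟦X⟧) = C 2 := (map_ofNat C 2).symm
  simp only [e2, coeff_C_mul, map_sum, coeff_X_pow, psi, coeff_mk, tri_iff]
  by_cases h : ∃ m : ℕ, m ^ 2 = 8 * d + 1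
  · obtain ⟨m, hm⟩ := h
    rcases Nat.even_or_odd' m with ⟨i, rfl | rfl⟩
    · exfalso
      rw [mul_pow] at hm
      omega
    · rw [← hm, sqz_sq, Finset.card_pair (by omega)]
      rw [Finset.sum_eq_single i]
      · simp
      · intro b _ hb
        rw [if_neg]
        intro h
        have := Nat.pow_left_injective (by norm_num : (2:ℕ) ≠ 0) h
        simp at this
        omega
      · intro h
        simp at h
        nlinarith
  · push Not at h
    rw [sqz_nonsq _ h, Finset.sum_eq_zero]
    · simp
    · intro s _
      rw [if_neg (h _)]

theorem lim_prod (a b : ℕ) (ha : 0 < a) (c : ZMod 3) : ∃ F : (ZMod 3)⟦X⟧,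
    Tendsto (fun n => ∏ i ∈ Finset.range n, (1 + C c * X ^ (a * i + b))) atTop (𝓝 F) := by
  refine ⟨_, (Multipliable.hasProd ?_).tendsto_prod_nat⟩
  apply WithPiTopology.multipliable_one_add_of_tendsto_order_atTop_nhds_top
  refine ENat.tendsto_nhds_top_iff_natCast_lt.mpr (fun n ↦ Filter.eventually_atTop.mpr ⟨n+1, ?_⟩)
  intro m hm
  refine lt_of_lt_of_le ?_ (le_order_mul _ _)
  rw [order_X_pow]
  refine lt_of_lt_of_le ?_ (le_add_self)
  norm_cast
  nlinarith

theorem lim_small (f : ℕ → (ZMod 3)⟦X⟧) : Tendsto (fun n => X ^ (n+1) * f n) atTop (𝓝 0) := by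
  apply tendsto_of_eventually_coeff
  intro d n hd
  rw [coeff_X_pow_mul', if_neg (by omega), map_zero]

/-- odd product -/
noncomputable def Op (n : ℕ) : (ZMod 3)⟦X⟧ := ∏ i ∈ Finset.range n, (1 - X ^ (2 * i + 1))
/-- even product -/
noncomputable def Ep (n : ℕ) : (ZMod 3)⟦X⟧ := ∏ i ∈ Finset.range n, (1 - X ^ (2 * i + 2))
/-- product of `1 - q^i` -/
noncomputable def Np (n : ℕ) : (ZMod 3)⟦X⟧ := ∏ i ∈ Finset.range n, (1 - X ^ (i + 1))
/-- product of `1 + q^i` -/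
noncomputable def Dp (n : ℕ) : (ZMod 3)⟦X⟧ := ∏ i ∈ Finset.range n, (1 + X ^ (i + 1))

theorem cc_Op (n : ℕ) : constantCoeff (Op n) ≠ 0 := by simp [Op, map_prod]
theorem cc_Ep (n : ℕ) : constantCoeff (Ep n) ≠ 0 := by simp [Ep, map_prod]
theorem cc_Np (n : ℕ) : constantCoeff (Np n) ≠ 0 := by simp [Np, map_prod]
theorem cc_Dp (n : ℕ) : constantCoeff (Dp n) ≠ 0 := by simp [Dp, map_prod]

theorem Op_inv (n : ℕ) : Op n * (Op n)⁻¹ = 1 := PowerSeries.mul_inv_cancel _ (cc_Op n)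
theorem Ep_inv (n : ℕ) : Ep n * (Ep n)⁻¹ = 1 := PowerSeries.mul_inv_cancel _ (cc_Ep n)
theorem Np_inv (n : ℕ) : Np n * (Np n)⁻¹ = 1 := PowerSeries.mul_inv_cancel _ (cc_Np n)
theorem Dp_inv (n : ℕ) : Dp n * (Dp n)⁻¹ = 1 := PowerSeries.mul_inv_cancel _ (cc_Dp n)

theorem Op_succ (n : ℕ) : Op (n+1) = Op n * (1 - X ^ (2 * n + 1)) := Finset.prod_range_succ _ _
theorem Ep_succ (n : ℕ) : Ep (n+1) = Ep n * (1 - X ^ (2 * n + 2)) := Finset.prod_range_succ _ _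
theorem Np_succ (n : ℕ) : Np (n+1) = Np n * (1 - X ^ (n + 1)) := Finset.prod_range_succ _ _
theorem Dp_succ (n : ℕ) : Dp (n+1) = Dp n * (1 + X ^ (n + 1)) := Finset.prod_range_succ _ _

theorem inv_step {R : Type*} [CommRing R] (a ai a' ai' b b' u v : R) (ha : a * ai = 1)
    (ha' : a' * ai' = 1) (hb : b' = b * v) (haa : a' = a * u) : 
    (b' * ai') * u = (b * ai) * v := by
  subst hb haa
  linear_combination b * v * ai * ha' - b * v * ai' * u * ha

theorem psi_fin (n : ℕ) : ∃ f, Op n * ∑ s ∈ Finset.range (2 * n + 1), X^(s*(s+1)/2) =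
    Ep n + X ^ (n + 1) * f := by
  have h := shanks_psi (X : (ZMod 3)⟦X⟧) (fun n => Ep n * (Op n)⁻¹) (fun n => Op n * (Ep n)⁻¹)
    (fun n => by linear_combination (Op n * (Op n)⁻¹) * Ep_inv n + Op_inv n)
    (fun n => by
      have h1 := Op_inv (n+1); have h2 := Op_inv n
      have h3 := Op_succ n; have h4 := Ep_succ n
      exact inv_step _ _ _ _ _ _ _ _ h2 h1 h4 h3)
    (fun n => by
      have h1 := Ep_inv (n+1); have h2 := Ep_inv n
      have h3 := Op_succ n; have h4 := Ep_succ n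
      exact inv_step _ _ _ _ _ _ _ _ h2 h1 h3 h4)
    (fun n => by rw [PowerSeries.isUnit_iff_constantCoeff]; simp) n
  rw [← h, Finset.sum_range_succ']
  have h0 : Op 0 * (Ep 0)⁻¹ = 1 := by
    have := Ep_inv 0
    simpa [Op, Ep] using this
  refine ⟨∑ s ∈ Finset.range n, Ep n * (Op (s+1) * (Ep (s+1))⁻¹) * X ^ (n + s * (2 * n + 1)), ?_⟩
  simp only [zero_mul, pow_zero, mul_one, h0]
  rw [mul_add, Finset.mul_sum, Finset.mul_sum, add_comm]
  have h1 := Op_inv n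
  congr 1
  · linear_combination Ep n * h1
  · refine Finset.sum_congr rfl fun s _ => ?_
    rw [show (s+1)*(2*n+1) = (n+1) + (n + s*(2*n+1)) by ring, pow_add]
    linear_combination Ep n * (Op (s+1) * (Ep (s+1))⁻¹) * X^(n+1) * X ^ (n + s * (2 * n + 1)) * h1

theorem phi_fin (n : ℕ) : ∃ f, Dp n * (1 + 2 * ∑ s ∈ Finset.range n, (-1)^(s+1) * X^((s+1)^2)) =
    Np n + X ^ (n + 1) * f := by
  have two : ∀ m : ℕ, (2 * (1 + X ^ m : (ZMod 3)⟦X⟧)⁻¹) * (1 + X ^ m) = 2 := by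
    intro m
    rw [mul_assoc, PowerSeries.inv_mul_cancel, mul_one]
    rcases m with _ | m
    · simp; decide
    · simp
  have h := shanks_phi (X : (ZMod 3)⟦X⟧) (fun n => Np n * (Dp n)⁻¹) (fun n => Dp n * (Np n)⁻¹)
    (fun n => 2 * (1 + X ^ n)⁻¹)
    (fun n => by linear_combination (Np n * (Np n)⁻¹) * Dp_inv n + Np_inv n)
    (fun n => by
      have h1 := Dp_inv (n+1); have h2 := Dp_inv n
      have h3 := Dp_succ n; have h4 := Np_succ n
      exact inv_step _ _ _ _ _ _ _ _ h2 h1 h4 h3)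
    (fun n => by
      have h1 := Np_inv (n+1); have h2 := Np_inv n
      have h3 := Dp_succ n; have h4 := Np_succ n
      exact inv_step _ _ _ _ _ _ _ _ h2 h1 h3 h4)
    (by
      rw [pow_zero, show (1 + 1 : (ZMod 3)⟦X⟧) = 2 by norm_num]
      apply PowerSeries.mul_inv_cancel
      simp
      decide)
    two
    (fun n => by rw [PowerSeries.isUnit_iff_constantCoeff]; simp) n
  rw [← h, Finset.sum_range_succ']
  have h0 : Dp 0 * (Np 0)⁻¹ = 1 := by
    have := Np_inv 0
    simpa [Dp, Np] using this
  have hc : 2 * (1 + X ^ 0 : (ZMod 3)⟦X⟧)⁻¹ = 1 := by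
    rw [pow_zero, show (1 + 1 : (ZMod 3)⟦X⟧) = 2 by norm_num]
    apply PowerSeries.mul_inv_cancel
    simp
    decide
  refine ⟨∑ s ∈ Finset.range n, (-1)^(s+1) * (2 * (1 + X ^ (s+1))⁻¹) *
    Np n * (Dp (s+1) * (Np (s+1))⁻¹) * X ^ (s * (n + 1)), ?_⟩
  simp only [hc]
  simp only [zero_mul, pow_zero, mul_one, h0, one_mul]
  rw [mul_add, Finset.mul_sum, Finset.mul_sum, add_comm]
  have h1 := Dp_inv n
  congr 1
  · linear_combination Np n * h1
  · refine Finset.sum_congr rfl fun s _ => ?_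
    rw [show (s+1)*(n+1) = (n+1) + (s*(n+1)) by ring, pow_add]
    linear_combination (-1)^(s+1) * (2 * (1 + X ^ (s+1))⁻¹) *
      Np n * (Dp (s+1) * (Np (s+1))⁻¹) * X^(n+1) * X ^ (s * (n + 1)) * h1

/-- generating function of `a 5` mod 3 -/
noncomputable def GG : (ZMod 3)⟦X⟧ := PowerSeries.mk fun n => (a 5 n : ZMod 3)

theorem GG_lim : Tendsto (fun N => PowerSeries.mk fun n => ((msT (Tset N) n).ncard : ZMod 3))
    atTop (𝓝 GG) := by
  apply tendsto_of_eventually_coeff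
  intro d n hd
  simp only [GG, coeff_mk, a_eq_msT n d hd]

theorem Np_two (n : ℕ) : Np (2 * n) = Op n * Ep n := by
  induction n with
  | zero => simp [Np, Op, Ep]
  | succ n ih =>
    rw [show 2 * (n+1) = 2 * n + 1 + 1 by ring, Np_succ, Np_succ, ih, Op_succ, Ep_succ]
    ring

theorem DN (n : ℕ) : Dp n * Np n = Ep n := by
  rw [Dp, Np, Ep, ← Finset.prod_mul_distrib]
  refine Finset.prod_congr rfl fun i _ => ?_
  ring

theorem cc_of_lim (f : ℕ → (ZMod 3)⟦X⟧) (F) (h : Tendsto f atTop (𝓝 F))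
    (hf : ∀ n, constantCoeff (f n) = 1) : F ≠ 0 := by
  have := (WithPiTopology.continuous_constantCoeff (ZMod 3)).continuousAt.tendsto.comp h
  have h2 : constantCoeff F = 1 := by
    apply tendsto_nhds_unique this
    simp [Function.comp_def, hf]
  rintro rfl
  simp at h2

theorem main_id : 2 * (GG * phi ^ 2) = psi := by
  obtain ⟨O, hO⟩ : ∃ F, Tendsto Op atTop (𝓝 F) := by
    unfold Op; simpa [sub_eq_add_neg] using lim_prod 2 1 (by norm_num) (-1)
  obtain ⟨E, hE⟩ : ∃ F, Tendsto Ep atTop (𝓝 F) := by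
    unfold Ep; simpa [sub_eq_add_neg] using lim_prod 2 2 (by norm_num) (-1)
  obtain ⟨N, hN⟩ : ∃ F, Tendsto Np atTop (𝓝 F) := by
    unfold Np; simpa [sub_eq_add_neg] using lim_prod 1 1 (by norm_num) (-1)
  obtain ⟨D, hD⟩ : ∃ F, Tendsto Dp atTop (𝓝 F) := by
    unfold Dp; simpa [sub_eq_add_neg] using lim_prod 1 1 (by norm_num) 1
  have i1 : N = O * E := by
    have h1 : Tendsto (fun n => Np (2 * n)) atTop (𝓝 N) :=
      hN.comp (tendsto_id.const_mul_atTop' (by norm_num : (0:ℕ) < 2))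
    simp only [Np_two] at h1
    exact tendsto_nhds_unique h1 (hO.mul hE)
  have i2 : D * N = E := by
    have h1 := hD.mul hN
    simp only [DN] at h1
    exact tendsto_nhds_unique h1 hE
  have i3 : D * phi = N := by
    choose f hf using phi_fin
    have h1 := hD.mul phi_lim
    simp only [hf] at h1
    simpa using tendsto_nhds_unique h1 (hN.add (lim_small f))
  have i4 : O * psi = 2 * E := by
    choose f hf using psi_fin
    have h1 := hO.mul psi_lim
    have e : ∀ n, Op n * (2 * ∑ s ∈ Finset.range (2 * n + 1), X^(s*(s+1)/2)) =
      2 * Ep n + X^(n+1) * (2 * f n) := by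
      intro n
      linear_combination 2 * hf n
    simp only [e] at h1
    simpa using tendsto_nhds_unique h1 ((hE.const_mul 2).add (lim_small _))
  have i5 : GG * (O ^ 5 * E) = 1 := by
    have h1 := GG_lim.mul ((hO.pow 5).mul hE)
    have e : ∀ n, (PowerSeries.mk fun m => ((msT (Tset n) m).ncard : ZMod 3)) * (Op n ^ 5 * Ep n) = 1 := by
      intro n
      have := msT_gen (ZMod 3) (Tset n) (Tset_pos n)
      rwa [Tset_prod] at this
    simp only [e] at h1
    exact (tendsto_nhds_unique h1 tendsto_const_nhds)
  have hE0 : E ≠ 0 := cc_of_lim _ _ hE (by simp [Ep, map_prod])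
  have i6 : D * O = 1 := by
    apply mul_right_cancel₀ hE0
    rw [i1] at i2
    linear_combination i2
  have i7 : phi = O ^ 2 * E := by
    linear_combination O * i3 - phi * i6 + O * i1
  rw [i7]
  have i8 : GG * O^4 * E^2 = D * E := by
    linear_combination D * E * i5 - GG * O^4 * E^2 * i6
  linear_combination 2 * i8 - D * i4 + psi * i6

/-- representations of `M` by `x^2 + 8 y^2` -/
noncomputable def Rep8 (M : ℕ) : Finset (ℤ × ℤ) :=
  (Finset.Icc (-M : ℤ) M ×ˢ Finset.Icc (-M : ℤ) M).filter (fun p => p.1 ^ 2 + 8 * p.2 ^ 2 = M)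

theorem mem_Rep (M : ℕ) (p : ℤ × ℤ) : p ∈ Rep8 M ↔ p.1 ^ 2 + 8 * p.2 ^ 2 = M := by
  simp only [Rep8, Finset.mem_filter, Finset.mem_product, Finset.mem_Icc, and_iff_right_iff_imp]
  intro h
  refine ⟨⟨?_, ?_⟩, ?_, ?_⟩ <;> nlinarith [sq_nonneg p.1, sq_nonneg p.2]

/-- sign -/
noncomputable def sg (y : ℤ) : ZMod 3 := (-1) ^ y.natAbs

theorem sg_even {y : ℤ} (h : Even y) : sg y = 1 := by
  rw [sg, Even.neg_one_pow]; exact Int.natAbs_even.2 h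
theorem sg_odd {y : ℤ} (h : Odd y) : sg y = -1 := by
  rw [sg, Odd.neg_one_pow]; exact Int.natAbs_odd.2 h

theorem sg_opp {x y : ℤ} (h : Odd (x + y)) : sg x = - sg y := by
  rcases Int.even_or_odd y with hy | hy
  · have : Odd x := by
      rw [Int.odd_iff] at *; rw [Int.even_iff] at hy; omega
    rw [sg_even hy, sg_odd this]
  · have : Even x := by
      rw [Int.odd_iff] at *; rw [Int.even_iff]; omega
    rw [sg_odd hy, sg_even this]; simp

theorem sg_three (y : ℤ) : sg (3 * y) = sg y := by
  rw [sg, sg, Int.natAbs_mul, pow_mul]; norm_num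

theorem sq_mod3 (x : ℤ) : (x % 3 = 0 ∧ x ^ 2 % 3 = 0) ∨ (x % 3 = 1 ∧ x ^ 2 % 3 = 1) ∨
    (x % 3 = 2 ∧ x ^ 2 % 3 = 1) := by
  have : x % 3 = 0 ∨ x % 3 = 1 ∨ x % 3 = 2 := by omega
  rcases this with h | h | h <;> simp [h, pow_two, Int.mul_emod]

theorem Rep_odd {M : ℕ} (hM : Odd M) {p : ℤ × ℤ} (hp : p ∈ Rep8 M) : Odd p.1 := by
  rw [mem_Rep] at hp
  have : Odd (p.1 ^ 2) := by
    have h : Odd (M : ℤ) := by exact_mod_cast hM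
    rw [← hp] at h
    rw [Int.odd_iff] at *
    omega
  exact (Int.odd_pow' (by norm_num)).1 this

theorem sum_flip {M : ℕ} (hM : Odd M) :
    ∑ p ∈ (Rep8 M).filter (fun p => 3 ∣ p.1 + p.2), sg p.2 =
    - ∑ p ∈ (Rep8 M).filter (fun p => 3 ∣ p.1 - p.2), sg p.2 := by
  rw [← Finset.sum_neg_distrib]
  refine Finset.sum_bij' (fun p _ => ((p.1 - 8 * p.2) / 3, (p.1 + p.2) / 3))
    (fun p _ => ((p.1 + 8 * p.2) / 3, (p.2 - p.1) / 3)) ?_ ?_ ?_ ?_ ?_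
  · rintro ⟨x, y⟩ hp
    simp only [Finset.mem_filter, mem_Rep] at hp ⊢
    obtain ⟨h, k, hk⟩ := hp
    obtain rfl : x = 3 * k - y := by omega
    have e1 : (3 * k - y - 8 * y) / 3 = k - 3 * y := by omega
    have e2 : (3 * k - y + y) / 3 = k := by omega
    rw [e1, e2]
    exact ⟨by linear_combination h, ⟨-y, by ring⟩⟩
  · rintro ⟨x, y⟩ hp
    simp only [Finset.mem_filter, mem_Rep] at hp ⊢
    obtain ⟨h, k, hk⟩ := hp
    obtain rfl : x = 3 * k + y := by omega
    have e1 : (3 * k + y + 8 * y) / 3 = k + 3 * y := by omega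
    have e2 : (y - (3 * k + y)) / 3 = -k := by omega
    rw [e1, e2]
    exact ⟨by linear_combination h, ⟨y, by ring⟩⟩
  · rintro ⟨x, y⟩ hp
    simp only [Finset.mem_filter] at hp
    simp only [Prod.mk.injEq]
    omega
  · rintro ⟨x, y⟩ hp
    simp only [Finset.mem_filter] at hp
    simp only [Prod.mk.injEq]
    omega
  · rintro ⟨x, y⟩ hp
    simp only [Finset.mem_filter] at hp
    have := Rep_odd hM hp.1
    simp only at this ⊢
    apply sg_opp
    rw [Int.odd_iff] at *
    omega

theorem rep_three {M : ℕ} (hM : Odd M) (h3 : 3 ∣ M) :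
    ∑ p ∈ Rep8 M, sg p.2 =
    - ∑ p ∈ (Rep8 M).filter (fun p => 3 ∣ p.1 ∧ 3 ∣ p.2), sg p.2 := by
  have h := Finset.sum_union_inter (s₁ := (Rep8 M).filter (fun p => 3 ∣ p.1 + p.2))
    (s₂ := (Rep8 M).filter (fun p => 3 ∣ p.1 - p.2)) (f := fun p => sg p.2)
  rw [sum_flip hM, neg_add_cancel] at h
  rw [← add_eq_zero_iff_eq_neg, ← h]
  congr 1
  · apply Finset.sum_congr _ (fun _ _ => rfl)
    ext ⟨x, y⟩
    simp only [Finset.mem_union, Finset.mem_filter, ← and_or_left]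
    refine ⟨fun h => ⟨h, ?_⟩, fun h => h.1⟩
    rw [mem_Rep] at h
    simp only at h
    obtain ⟨k, rfl⟩ := h3
    push_cast at h
    rcases sq_mod3 x with hx | hx | hx <;> rcases sq_mod3 y with hy | hy | hy <;> omega
  · apply Finset.sum_congr _ (fun _ _ => rfl)
    ext ⟨x, y⟩
    simp only [Finset.mem_inter, Finset.mem_filter]
    constructor
    · rintro ⟨h, h1, h2⟩
      exact ⟨⟨h, by omega⟩, h, by omega⟩
    · rintro ⟨⟨h, h1⟩, _, h2⟩
      exact ⟨h, by omega, by omega⟩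

theorem rep_nine (k : ℕ) :
    ∑ p ∈ (Rep8 (9 * k)).filter (fun p => 3 ∣ p.1 ∧ 3 ∣ p.2), sg p.2 = ∑ p ∈ Rep8 k, sg p.2 := by
  symm
  refine Finset.sum_bij' (fun p _ => (3 * p.1, 3 * p.2)) (fun p _ => (p.1 / 3, p.2 / 3)) ?_ ?_ ?_ ?_ ?_
  · rintro ⟨x, y⟩ hp
    simp only [Finset.mem_filter, mem_Rep] at hp ⊢
    push_cast
    exact ⟨by linear_combination 9 * hp, by simp, by simp⟩
  · rintro ⟨x, y⟩ hp
    simp only [Finset.mem_filter, mem_Rep] at hp ⊢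
    obtain ⟨h, ⟨u, rfl⟩, ⟨v, rfl⟩⟩ := hp
    push_cast at h
    simp
    linarith
  · rintro ⟨x, y⟩ hp
    simp
  · rintro ⟨x, y⟩ hp
    simp only [Finset.mem_filter] at hp
    simp only [Prod.mk.injEq]
    omega
  · rintro ⟨x, y⟩ hp
    exact (sg_three _).symm

theorem rep_not_nine (M : ℕ) (h : ¬ 9 ∣ M) :
    ∑ p ∈ (Rep8 M).filter (fun p => 3 ∣ p.1 ∧ 3 ∣ p.2), sg p.2 = 0 := by
  rw [Finset.filter_eq_empty_iff.2, Finset.sum_empty]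
  rintro ⟨x, y⟩ hp ⟨⟨u, hu⟩, ⟨v, hv⟩⟩
  rw [mem_Rep] at hp
  simp only at hu hv hp
  subst hu hv
  apply h
  zify
  rw [← hp]
  exact ⟨u ^ 2 + 8 * v ^ 2, by ring⟩

theorem coeff_psi_phi (n : ℕ) : coeff n (psi * phi) = ∑ p ∈ Rep8 (8 * n + 1), sg p.2 := by
  rw [coeff_mul]
  have hm : ∀ p ∈ Rep8 (8 * n + 1), (((p.1 ^ 2 - 1) / 8).toNat, (p.2 ^ 2).toNat) ∈
      Finset.HasAntidiagonal.antidiagonal n := by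
    rintro ⟨x, y⟩ hp
    have ho := Rep_odd ⟨4 * n, by ring⟩ hp
    rw [mem_Rep] at hp
    push_cast at hp
    simp only [Finset.HasAntidiagonal.mem_antidiagonal]
    have h1 := sq_nonneg y
    have h2 : 0 < x ^ 2 := by
      have : x ≠ 0 := by rintro rfl; simp at ho
      positivity
    omega
  rw [← Finset.sum_fiberwise_of_maps_to hm]
  refine Finset.sum_congr rfl ?_
  rintro ⟨i, j⟩ hij
  rw [Finset.HasAntidiagonal.mem_antidiagonal] at hij
  simp only at hij
  have : (Rep8 (8 * n + 1)).filter (fun p => (((p.1 ^ 2 - 1) / 8).toNat, (p.2 ^ 2).toNat) = (i, j)) =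
      sqz (8 * i + 1) ×ˢ sqz j := by
    ext ⟨x, y⟩
    simp only [Finset.mem_filter, mem_Rep, Finset.mem_product, mem_sqz, Prod.mk.injEq]
    push_cast
    have h1 := sq_nonneg y
    constructor
    · rintro ⟨h, h2, h3⟩
      constructor <;> omega
    · rintro ⟨h2, h3⟩
      refine ⟨?_, ?_, ?_⟩ <;> omega
  rw [this, Finset.sum_product]
  simp [psi, phi, sg]

theorem sqz_nine (n : ℕ) : sqz (9 * n) = (sqz n).image (fun y => 3 * y) := by
  ext y
  simp only [Finset.mem_image, mem_sqz]
  push_cast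
  constructor
  · intro h
    have h3 : 3 ∣ y := by
      rcases sq_mod3 y with h' | h' | h' <;> omega
    obtain ⟨z, rfl⟩ := h3
    exact ⟨z, by linarith, rfl⟩
  · rintro ⟨z, h, rfl⟩
    linarith

theorem sqz_three (m : ℕ) (h : ¬ 3 ∣ m) : sqz (3 * m) = ∅ := by
  ext y
  simp only [mem_sqz, Finset.notMem_empty, iff_false]
  push_cast
  intro hy
  have h3 : 3 ∣ y := by
    rcases sq_mod3 y with h' | h' | h' <;> omega
  obtain ⟨z, rfl⟩ := h3
  apply h
  zify
  exact ⟨z ^ 2, by linarith⟩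

theorem sqz_two (m : ℕ) (h : m % 3 = 2) : sqz m = ∅ := by
  ext y
  simp only [mem_sqz, Finset.notMem_empty, iff_false]
  intro hy
  rcases sq_mod3 y with h' | h' | h' <;> omega

/-- extraction of the progression `3n+r` -/
noncomputable def ex (r : ℕ) (F : (ZMod 3)⟦X⟧) : (ZMod 3)⟦X⟧ :=
  PowerSeries.mk fun n => coeff (3 * n + r) F

/-- substitution `q ↦ q^3` -/
noncomputable def e3 (F : (ZMod 3)⟦X⟧) : (ZMod 3)⟦X⟧ := PowerSeries.expand 3 (by norm_num) F

theorem coeff_e3 (F : (ZMod 3)⟦X⟧) (n : ℕ) :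
    coeff n (e3 F) = if 3 ∣ n then coeff (n / 3) F else 0 := coeff_expand _ _ _

theorem e3_mul (F H : (ZMod 3)⟦X⟧) : e3 (F * H) = e3 F * e3 H := map_mul _ _ _

theorem e3_cube (F : (ZMod 3)⟦X⟧) : F ^ 3 = e3 F := by
  have h := MvPowerSeries.map_frobenius_expand 3 (by norm_num) (f := F)
  rw [← h]
  have : frobenius (ZMod 3) 3 = RingHom.id _ := by
    ext x; exact ZMod.pow_card x
  rw [this]
  exact congrFun (congrArg _ MvPowerSeries.map_id) _

theorem ex_mul_e3 (r : ℕ) (hr : r < 3) (F H : (ZMod 3)⟦X⟧) : ex r (F * e3 H) = ex r F * H := by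
  ext n
  simp only [ex, coeff_mk, coeff_mul]
  symm
  refine Finset.sum_of_injOn (fun p => (3 * p.1 + r, 3 * p.2)) ?_ ?_ ?_ ?_
  · rintro ⟨a, b⟩ _ ⟨c, d⟩ _ h
    simp at h
    simp
    omega
  · rintro ⟨a, b⟩ h
    simp at h ⊢
    omega
  · rintro ⟨a, b⟩ h h'
    simp only [coeff_e3]
    rw [if_neg, mul_zero]
    rintro ⟨c, rfl⟩
    apply h'
    simp only [Finset.HasAntidiagonal.mem_antidiagonal] at h
    refine ⟨(n - c, c), ?_, ?_⟩
    · simp; omega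
    · simp; omega
  · rintro ⟨a, b⟩ h
    simp [coeff_e3]

theorem ex_sq : ex 0 (phi ^ 2) = e3 phi ^ 2 := by
  have h0 : ex 0 phi = e3 phi := by
    ext m
    rw [coeff_e3]
    simp only [ex, coeff_mk, phi, add_zero]
    split_ifs with h
    · obtain ⟨k, rfl⟩ := h
      rw [show 3 * (3 * k) = 9 * k by ring, sqz_nine, Finset.sum_image (by intro x _ y _ h; simpa using h)]
      simp only [Nat.mul_div_cancel_left k (by norm_num : 0 < 3)]
      exact Finset.sum_congr rfl fun y _ => sg_three y
    · rw [sqz_three m h, Finset.sum_empty]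
  rw [← h0, pow_two, pow_two]
  ext n
  simp only [ex, coeff_mk, coeff_mul]
  symm
  refine Finset.sum_of_injOn (fun p => (3 * p.1, 3 * p.2)) ?_ ?_ ?_ ?_
  · rintro ⟨a, b⟩ _ ⟨c, d⟩ _ h
    simp at h
    simp
    omega
  · rintro ⟨a, b⟩ h
    simp at h ⊢
    omega
  · rintro ⟨a, b⟩ h h'
    simp only [Finset.HasAntidiagonal.mem_antidiagonal] at h
    have ha : a % 3 = 0 ∨ a % 3 = 1 ∨ a % 3 = 2 := by omega
    rcases ha with ha | ha | ha
    · exfalso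
      apply h'
      refine ⟨(a / 3, b / 3), ?_, ?_⟩
      · simp; omega
      · simp; omega
    · simp only [phi, coeff_mk]
      rw [sqz_two b (by omega), Finset.sum_empty, mul_zero]
    · simp only [phi, coeff_mk]
      rw [sqz_two a (by omega), Finset.sum_empty, zero_mul]
  · rintro ⟨a, b⟩ h
    simp

theorem ex_psi_one : ex 1 psi = e3 psi := by
  ext m
  rw [coeff_e3]
  simp only [ex, coeff_mk, psi]
  split_ifs with h
  · obtain ⟨k, rfl⟩ := h
    rw [show 8 * (3 * (3 * k) + 1) + 1 = 9 * (8 * k + 1) by ring, sqz_nine,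
      Finset.card_image_of_injective _ (by intro x y h; simpa using h)]
    simp only [Nat.mul_div_cancel_left k (by norm_num : 0 < 3)]
  · rw [show 8 * (3 * m + 1) + 1 = 3 * (8 * m + 3) by ring, sqz_three _ (by omega)]
    simp

theorem ex_psi_two : ex 2 psi = 0 := by
  ext m
  simp only [ex, coeff_mk, psi]
  rw [sqz_two _ (by omega)]
  simp

theorem ex_psi_phi : ex 1 (psi * phi) = - e3 (psi * phi) := by
  ext m
  rw [map_neg, coeff_e3]
  simp only [ex, coeff_mk, coeff_psi_phi]
  rw [rep_three ⟨12 * m + 4, by ring⟩ ⟨8 * m + 3, by ring⟩]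
  congr 1
  split_ifs with h
  · obtain ⟨k, rfl⟩ := h
    rw [show 8 * (3 * (3 * k) + 1) + 1 = 9 * (8 * k + 1) by ring, rep_nine]
    simp only [Nat.mul_div_cancel_left k (by norm_num : 0 < 3)]
  · rw [rep_not_nine _ (by omega)]

/-- the auxiliary ternary theta series -/
noncomputable def AA : (ZMod 3)⟦X⟧ := psi * e3 phi ^ 2

theorem AA_eq : AA = psi * e3 (phi ^ 2) := by
  rw [AA, pow_two, pow_two, e3_mul]

theorem AA_two : ex 2 AA = 0 := by
  rw [AA_eq, ex_mul_e3 2 (by norm_num), ex_psi_two, zero_mul]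

theorem AA_one : ex 0 (ex 1 AA) = AA := by
  rw [AA_eq, ex_mul_e3 1 (by norm_num), ex_psi_one, mul_comm, ex_mul_e3 0 (by norm_num), ex_sq,
    ← AA_eq, AA, mul_comm]

theorem phi_ne : phi ≠ 0 := by
  intro h
  have : coeff 0 phi = 1 := by
    simp only [phi, coeff_mk]
    have := sqz_sq 0
    simp at this
    simp [this]
  rw [h] at this
  simp at this

theorem ex_smul (r : ℕ) (c : ZMod 3) (F : (ZMod 3)⟦X⟧) : ex r (C c * F) = C c * ex r F := by
  ext n; simp [ex]

theorem GG_AA : ex 0 (ex 1 GG) = AA := by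
  have two : (2 : (ZMod 3)⟦X⟧) = C (-1) := by
    rw [← map_ofNat C 2]; rfl
  have h := main_id
  have h9 : C (-1) * (GG * e3 (e3 phi)) = (psi * phi) * e3 (phi ^ 2) := by
    rw [← e3_cube, ← e3_cube, ← e3_cube, ← two, ← h]
    ring
  have h1 := congrArg (ex 1) h9
  rw [ex_smul, ex_mul_e3 1 (by norm_num), ex_mul_e3 1 (by norm_num), ex_psi_phi] at h1
  have h2 : ex 1 GG * e3 phi = phi ^ 2 * e3 (psi * phi) := by
    have e : (C (-1) : (ZMod 3)⟦X⟧) = -1 := by simp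
    rw [e] at h1
    linear_combination -h1
  have h3 := congrArg (ex 0) h2
  rw [ex_mul_e3 0 (by norm_num), ex_mul_e3 0 (by norm_num), ex_sq] at h3
  apply mul_right_cancel₀ phi_ne
  rw [h3, AA]
  ring

theorem AA_zero (α n : ℕ) :
    coeff (3 ^ (2 * α + 1) * n + (17 * 3 ^ (2 * α) - 1) / 8) AA = 0 := by
  induction α with
  | zero =>
    have := congrArg (coeff n) AA_two
    simpa [ex] using this
  | succ α ih =>
    have := congrArg (coeff (3 ^ (2 * α + 1) * n + (17 * 3 ^ (2 * α) - 1) / 8)) AA_one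
    rw [ih] at this
    simp only [ex, coeff_mk] at this
    convert this using 2
    have h8 : 3 ^ (2 * α) % 8 = 1 := by
      rw [pow_mul, Nat.pow_mod]; norm_num
    have e1 : 3 ^ (2 * (α + 1) + 1) * n = 9 * (3 ^ (2 * α + 1) * n) := by ring
    have e2 : 3 ^ (2 * (α + 1)) = 9 * 3 ^ (2 * α) := by ring
    rw [e1, e2]
    congr 1
    omega

theorem stmt1 (α n : ℕ) :
    a 5 (3 ^ (2 * α + 3) * n + (153 * 3 ^ (2 * α) - 1) / 8) ≡ 0 [MOD 3] := by
  rw [← ZMod.natCast_eq_natCast_iff]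
  have h := congrArg (coeff (3 ^ (2 * α + 1) * n + (17 * 3 ^ (2 * α) - 1) / 8)) GG_AA
  rw [AA_zero] at h
  simp only [ex, coeff_mk, GG] at h
  rw [Nat.cast_zero, ← h]
  congr 2
  have h8 : 3 ^ (2 * α) % 8 = 1 := by
    rw [pow_mul, Nat.pow_mod]; norm_num
  have e1 : 3 ^ (2 * α + 3) * n = 9 * (3 ^ (2 * α + 1) * n) := by ring
  rw [e1]
  omega
end

section
/- For all integers j ≥ 0 and n ≥ 0, a_{5j+5}(5n + 3) ≡ 0 (mod 5). -/
namespace Ram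
open PowerSeries Finset

local instance : Fact (Nat.Prime 5) := ⟨by norm_num⟩

/-- finite Euler product -/
noncomputable def P (n : ℕ) : (ZMod 5)⟦X⟧ := ∏ i ∈ range n, (1 - X ^ (i + 1))

/-- q-binomial coefficients -/
noncomputable def g : ℕ → ℕ → (ZMod 5)⟦X⟧
  | _, 0 => 1
  | 0, _ + 1 => 0
  | n + 1, k + 1 => g n k + X ^ (k + 1) * g n (k + 1)

lemma P_succ (n : ℕ) : P (n + 1) = P n * (1 - X ^ (n + 1)) := by
  simp [P, prod_range_succ]

lemma g_zero (n : ℕ) : g n 0 = 1 := by cases n <;> rfl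

lemma g_succ (n k : ℕ) : g (n+1) (k+1) = g n k + X ^ (k + 1) * g n (k + 1) := rfl

lemma g_of_lt : ∀ (n k : ℕ), n < k → g n k = 0
  | 0, k + 1, _ => rfl
  | n + 1, k + 1, h => by
    rw [g_succ, g_of_lt n k (by omega), g_of_lt n (k+1) (by omega)]; simp

lemma g_P : ∀ (n a b : ℕ), a + b = n → g n a * P a * P b = P n
  | n, 0, b, h => by
    obtain rfl : b = n := by omega
    simp [g_zero, P]
  | 0, a + 1, b, h => by omega
  | n + 1, a + 1, 0, h => by
    obtain rfl : a = n := by omega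
    have h1 := g_P a a 0 (by omega)
    rw [g_succ, g_of_lt a (a+1) (by omega), P_succ]
    linear_combination (1 - X ^ (a + 1)) * h1
  | n + 1, a + 1, b + 1, h => by
    have h1 := g_P n a (b + 1) (by omega)
    have h2 := g_P n (a + 1) b (by omega)
    have hn : n + 1 = (a + 1) + (b + 1) := by omega
    rw [g_succ, P_succ n]
    have e : (X : (ZMod 5)⟦X⟧) ^ (n + 1) = X ^ (a + 1) * X ^ (b + 1) := by rw [hn, pow_add]
    rw [e]
    have pa := P_succ a
    have pb := P_succ b
    linear_combination (1 - X ^ (a + 1)) * h1 + X ^ (a + 1) * (1 - X ^ (b + 1)) * h2 +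
      g n a * P (b + 1) * pa + X ^ (a + 1) * g n (a + 1) * P (a + 1) * pb

/-- q-binomial theorem -/
lemma qbinom {A : Type*} [CommRing A] (f : (ZMod 5)⟦X⟧ →+* A) (y : A) : ∀ (N : ℕ) (x : A),
    ∏ i ∈ range N, (y + x * f X ^ i) =
      ∑ k ∈ range (N + 1), f X ^ (k * (k - 1) / 2) * f (g N k) * x ^ k * y ^ (N - k)
  | 0, x => by simp [g_zero]
  | N + 1, x => by
    have ih := qbinom f y N (x * f X)
    rw [prod_range_succ']
    have e : ∀ i ∈ range N, y + x * f X ^ (i + 1) = y + x * f X * f X ^ i := by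
      intros; ring
    rw [prod_congr rfl e, ih, mul_add, sum_mul, sum_mul]
    have tri : ∀ k, (k + 1) * (k + 1 - 1) / 2 = k * (k - 1) / 2 + k := by
      intro k
      have := Nat.triangle_succ k
      simpa using this
    rw [sum_range_succ' _ (N + 1)]
    have e2 : ∀ k ∈ range (N + 1), f X ^ ((k + 1) * (k + 1 - 1) / 2) * f (g (N + 1) (k + 1)) * x ^ (k + 1) * y ^ (N + 1 - (k + 1))
        = f X ^ (k * (k - 1) / 2) * f (g N k) * (x * f X) ^ k * y ^ (N - k) * (x * f X ^ 0)
         + f X ^ ((k + 1) * (k + 1 - 1) / 2) * f (g N (k + 1)) * (x * f X) ^ (k + 1) * y ^ (N - k) := by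
      intro k hk
      rw [g_succ, tri, map_add, map_mul, map_pow, Nat.add_sub_add_right]
      ring
    have e3 : ∀ k ∈ range N, f X ^ ((k + 1) * (k + 1 - 1) / 2) * f (g N (k + 1)) * (x * f X) ^ (k + 1) * y ^ (N - k)
        = f X ^ ((k + 1) * (k + 1 - 1) / 2) * f (g N (k + 1)) * (x * f X) ^ (k + 1) * y ^ (N - (k + 1)) * y := by
      intro k hk
      have : N - k = N - (k + 1) + 1 := by have := mem_range.1 hk; omega
      rw [this]; ring
    have e4 : ∑ k ∈ range (N + 1), f X ^ ((k + 1) * (k + 1 - 1) / 2) * f (g N (k + 1)) * (x * f X) ^ (k + 1) * y ^ (N - k)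
        = ∑ k ∈ range N, f X ^ ((k + 1) * (k + 1 - 1) / 2) * f (g N (k + 1)) * (x * f X) ^ (k + 1) * y ^ (N - (k + 1)) * y := by
      rw [sum_range_succ, sum_congr rfl e3, g_of_lt N (N + 1) (by omega)]
      simp
    have e5 := sum_range_succ' (fun k => f X ^ (k * (k - 1) / 2) * f (g N k) * (x * f X) ^ k * y ^ (N - k) * y) N
    rw [sum_congr rfl e2, sum_add_distrib, e4, e5]
    simp only [g_zero, map_one]
    simp only [Nat.sub_zero, pow_zero, Nat.zero_sub, Nat.zero_div, mul_one, one_mul, zero_mul]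
    ring

lemma prod1 (n : ℕ) : ∏ i ∈ range n, ((X : (ZMod 5)⟦X⟧) ^ n - X ^ i) =
    (-1) ^ n * X ^ (n * (n - 1) / 2) * P n := by
  have e : ∀ i ∈ range n, (X : (ZMod 5)⟦X⟧) ^ n - X ^ i = (-1) * X ^ i * (1 - X ^ (n - 1 - i + 1)) := by
    intro i hi
    have hi := mem_range.1 hi
    have : n = i + (n - 1 - i + 1) := by omega
    conv_lhs => rw [this, pow_add]
    ring
  rw [prod_congr rfl e, prod_mul_distrib, prod_mul_distrib, prod_const, card_range,
    prod_pow_eq_pow_sum, sum_range_id, P, prod_range_reflect (fun i => 1 - (X : (ZMod 5)⟦X⟧) ^ (i + 1))]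

lemma prod2 (n : ℕ) : ∏ i ∈ range n, ((X : (ZMod 5)⟦X⟧) ^ n - X ^ (n + (i + 1))) =
    X ^ (n * n) * P n := by
  have e : ∀ i ∈ range n, (X : (ZMod 5)⟦X⟧) ^ n - X ^ (n + (i + 1)) = X ^ n * (1 - X ^ (i + 1)) := by
    intro i hi
    ring
  rw [prod_congr rfl e, prod_mul_distrib, prod_const, card_range, P, pow_mul]

lemma jac1 (n : ℕ) : (X : (ZMod 5)⟦X⟧) ^ n * ((-1) ^ n * X ^ (n * (n - 1) / 2) * P n) * (X ^ (n * n) * P n) =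
    ∑ k ∈ range (2 * n + 2), X ^ (k * (k - 1) / 2) * g (2 * n + 1) k * ((k : (ZMod 5)⟦X⟧) * (-1) ^ (k - 1)) *
      X ^ (n * (2 * n + 1 - k)) := by
  have h := qbinom (Polynomial.C : (ZMod 5)⟦X⟧ →+* _) (Polynomial.C (X ^ n)) (2 * n + 1) Polynomial.X
  have hN : 2 * n + 1 = n + (n + 1) := by ring
  conv_lhs at h => rw [hN, prod_range_add, prod_range_succ', ← mul_assoc]
  have h' := congrArg (fun p => Polynomial.eval (-1) (Polynomial.derivative p)) h
  simp only [Polynomial.derivative_mul, Polynomial.eval_add, Polynomial.eval_mul,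
    Polynomial.eval_prod, Polynomial.derivative_sum, Polynomial.eval_finsetSum] at h'
  simp [← map_pow, ← sub_eq_add_neg, prod1, prod2, Polynomial.derivative_X_pow] at h'
  simp only [← pow_mul] at h'
  rw [← h']
  ring

lemma two_tri (k : ℕ) : 2 * (k * (k - 1) / 2) + k = k * k := by
  rw [Nat.mul_div_cancel' (Nat.even_mul_pred_self k).two_dvd]
  cases k <;> simp; ring

lemma jac2 (n : ℕ) : P n ^ 2 = ∑ m ∈ range (n + 1), (-1) ^ m * X ^ ((m + 1) * m / 2) *
    (((n + 1 + m : ℕ) : (ZMod 5)⟦X⟧) * g (2 * n + 1) (n + 1 + m)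
      - ((n - m : ℕ) : (ZMod 5)⟦X⟧) * g (2 * n + 1) (n - m)) := by
  have h := jac1 n
  have hN : 2 * n + 2 = (n + 1) + (n + 1) := by ring
  rw [hN, sum_range_add, ← sum_range_reflect, ← sum_add_distrib] at h
  set E := n + n * (n - 1) / 2 + n * n with hE
  have hX : (X : (ZMod 5)⟦X⟧) ^ E * (-1) ^ n ≠ 0 := by
    apply mul_ne_zero
    · exact pow_ne_zero _ X_ne_zero
    · exact pow_ne_zero _ (by simp)
  apply mul_left_cancel₀ hX
  have : (X : (ZMod 5)⟦X⟧) ^ E * (-1) ^ n * P n ^ 2 = X ^ n * ((-1) ^ n * X ^ (n * (n - 1) / 2) * P n) * (X ^ (n * n) * P n) := by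
    rw [hE]; ring
  rw [this, h, mul_sum]
  apply sum_congr rfl
  intro m hm
  have hm : m ≤ n := by have := mem_range.1 hm; omega
  obtain ⟨d, rfl⟩ := Nat.exists_eq_add_of_le hm
  have i1 : m + d + 1 - 1 - m = d := by omega
  have i2 : m + d - m = d := by omega
  have i3 : 2 * (m + d) + 1 - d = m + d + 1 + m := by omega
  have i4 : 2 * (m + d) + 1 - (m + d + 1 + m) = d := by omega
  have i5 : m + d + 1 + m - 1 = m + d + m := by omega
  rw [i1, i2, i3, i4]
  have t1 := two_tri d
  have t2 := two_tri (m + d + 1 + m)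
  have t3 := two_tri (m + d)
  have t4 := two_tri (m + 1)
  rw [Nat.add_sub_cancel] at t4
  have x1 : d * (d - 1) / 2 + (m + d) * (m + d + 1 + m) = E + (m + 1) * m / 2 := by
    nlinarith
  have x2 : (m + d + 1 + m) * (m + d + 1 + m - 1) / 2 + (m + d) * d = E + (m + 1) * m / 2 := by
    nlinarith
  have s1 : (d : (ZMod 5)⟦X⟧) * (-1) ^ (d - 1) = - (d * (-1) ^ (m + d) * (-1) ^ m) := by
    have hsq : ((-1 : (ZMod 5)⟦X⟧)) ^ m * (-1) ^ m = 1 := by rw [← mul_pow]; simp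
    rcases d with _ | d
    · simp
    · rw [Nat.add_sub_cancel]
      rw [pow_add, pow_succ]
      linear_combination (-((d + 1 : ℕ) : (ZMod 5)⟦X⟧) * (-1) ^ d) * hsq
  have s2 : ((-1 : (ZMod 5)⟦X⟧)) ^ (m + d + m) = (-1) ^ (m + d) * (-1) ^ m := by rw [pow_add]
  rw [s1, i5, s2]
  rw [i5] at x2
  generalize (-1 : (ZMod 5)⟦X⟧) ^ (m + d) = σ
  have y1 : (X : (ZMod 5)⟦X⟧) ^ (d * (d - 1) / 2) * X ^ ((m + d) * (m + d + 1 + m)) = X ^ E * X ^ ((m + 1) * m / 2) := by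
    rw [← pow_add, ← pow_add, x1]
  have y2 : (X : (ZMod 5)⟦X⟧) ^ ((m + d + 1 + m) * (m + d + m) / 2) * X ^ ((m + d) * d) = X ^ E * X ^ ((m + 1) * m / 2) := by
    rw [← pow_add, ← pow_add, x2]
  linear_combination (g (2 * (m + d) + 1) d * (-(d * σ * (-1) ^ m))) * y1 + (g (2 * (m + d) + 1) (m + d + 1 + m) * (((m + d + 1 + m : ℕ) : (ZMod 5)⟦X⟧) * (σ * (-1) ^ m))) * y2

/-- the Euler product -/
noncomputable abbrev φ : (ZMod 5)⟦X⟧ := pentagonalSeries (ZMod 5)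

/-- truncation -/
noncomputable abbrev π (M : ℕ) : (ZMod 5)⟦X⟧ →+* (ZMod 5)⟦X⟧ ⧸ Ideal.span {(X : (ZMod 5)⟦X⟧) ^ M} :=
  Ideal.Quotient.mk _

lemma π_eq_iff {M : ℕ} {f h : (ZMod 5)⟦X⟧} : π M f = π M h ↔ ∀ d < M, coeff d f = coeff d h := by
  rw [Ideal.Quotient.eq, Ideal.mem_span_singleton, X_pow_dvd_iff]
  simp [sub_eq_zero]

lemma π_X {M d : ℕ} (h : M ≤ d) : π M (X ^ d) = 0 := by
  rw [Ideal.Quotient.eq_zero_iff_mem, Ideal.mem_span_singleton]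
  exact pow_dvd_pow _ h

lemma π_P_add (M n m : ℕ) (h : M ≤ n) : π M (P (n + m)) = π M (P n) := by
  induction m with
  | zero => rfl
  | succ m ih => rw [← add_assoc, P_succ, map_mul, ih, map_sub, π_X (by omega)]; simp

lemma π_P (M n : ℕ) (h : M ≤ n) : π M (P n) = π M φ := by
  rw [π_eq_iff]
  intro d hd
  have := (Filter.tendsto_finset_range).eventually (coeff_prod_one_sub_X_pow_eventually_eq (ZMod 5) d)
  obtain ⟨N, hN⟩ := Filter.eventually_atTop.1 this
  have h1 := hN (n + N) (by omega)
  rw [← h1]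
  exact (π_eq_iff.1 (π_P_add M n N h) d hd).symm

lemma coeff_φ_cube (e : ℕ) (h0 : e % 5 ≠ 0) (h1 : e % 5 ≠ 1) : coeff e (φ ^ 3) = 0 := by
  set M := e + 1 with hM
  have hu : IsUnit φ := by
    rw [PowerSeries.isUnit_iff_constantCoeff]
    have := π_eq_iff.1 (π_P 1 1 le_rfl) 0 (by omega)
    rw [coeff_zero_eq_constantCoeff_apply, coeff_zero_eq_constantCoeff_apply] at this
    rw [← this]
    simp [P]
  have hu' : IsUnit (π M φ) := hu.map _
  have hg : ∀ a b, M ≤ a → M ≤ b → π M φ * π M (g (a + b) a) = 1 := by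
    intro a b ha hb
    have := congrArg (π M) (g_P (a + b) a b rfl)
    rw [map_mul, map_mul, π_P M a ha, π_P M b hb, π_P M _ (by omega)] at this
    apply hu'.mul_left_cancel
    linear_combination this
  have key : π M (φ ^ 3) = π M (∑ m ∈ range (2 * M + 1), (-1) ^ m * X ^ ((m + 1) * m / 2) * ((2 * m + 1 : ℕ) : (ZMod 5)⟦X⟧)) := by
    have h := congrArg (π M) (jac2 (2 * M))
    rw [map_pow, π_P M _ (by omega), map_sum] at h
    rw [show φ ^ 3 = φ * φ ^ 2 by ring, map_mul, map_pow, h, map_sum, mul_sum]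
    apply sum_congr rfl
    intro m hm
    rw [map_mul _ (_ * _), map_mul _ (_ * _)]
    by_cases hmM : m < M
    · have a1 := hg (2 * M + 1 + m) (2 * M - m) (by omega) (by omega)
      have a2 := hg (2 * M - m) (2 * M + 1 + m) (by omega) (by omega)
      rw [show 2 * M + 1 + m + (2 * M - m) = 2 * (2 * M) + 1 by omega] at a1
      rw [show 2 * M - m + (2 * M + 1 + m) = 2 * (2 * M) + 1 by omega] at a2
      have hc : (2 * m + 1) + (2 * M - m) = 2 * M + 1 + m := by omega
      simp only [map_sub, map_mul]
      have hc' := congrArg (fun k : ℕ => π M (k : (ZMod 5)⟦X⟧)) hc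
      simp only [Nat.cast_add (R := (ZMod 5)⟦X⟧) (2 * m + 1), map_add] at hc'
      generalize π M ((2 * M + 1 + m : ℕ) : (ZMod 5)⟦X⟧) = u at *
      generalize π M ((2 * M - m : ℕ) : (ZMod 5)⟦X⟧) = v at *
      linear_combination (π M ((-1) ^ m) * π M (X ^ ((m + 1) * m / 2))) * (u * a1 - v * a2 - hc')
    · have : π M ((-1) ^ m * X ^ ((m + 1) * m / 2)) = 0 := by
        rw [map_mul, π_X, mul_zero]
        rw [Nat.le_div_iff_mul_le (by norm_num)]
        nlinarith
      rw [this]; simp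
  rw [π_eq_iff.1 key e (by omega), map_sum]
  apply sum_eq_zero
  intro m _
  have r : ((-1 : (ZMod 5)⟦X⟧) ^ m * X ^ ((m + 1) * m / 2) * ((2 * m + 1 : ℕ) : (ZMod 5)⟦X⟧)) =
     C ((-1 : ZMod 5) ^ m * ((2 * m + 1 : ℕ) : ZMod 5)) * X ^ ((m + 1) * m / 2) := by
    rw [map_mul, map_pow, map_neg, map_one, map_natCast]; ring
  rw [r, coeff_C_mul, coeff_X_pow]
  split_ifs with he
  · have t := two_tri (m + 1)
    rw [Nat.add_sub_cancel, ← he] at t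
    have t5 := congrArg (fun k : ℕ => (k : ZMod 5)) t
    push_cast at t5
    have dec : ∀ e m : ZMod 5, 2 * e + (m + 1) = (m + 1) * (m + 1) → e ≠ 0 → e ≠ 1 →
        2 * m + 1 = 0 := by decide
    have q0 : (e : ZMod 5) ≠ 0 := by
      intro h
      rw [ZMod.natCast_eq_zero_iff] at h
      omega
    have q1 : (e : ZMod 5) ≠ 1 := by
      intro h
      rw [← Nat.cast_one, ZMod.natCast_eq_natCast_iff'] at h
      omega
    push_cast
    rw [dec e m t5 q0 q1]; simp
  · simp

/-- support of a power series contained in residues satisfying `p` -/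
def Supp (p : ℕ → Prop) (f : (ZMod 5)⟦X⟧) : Prop := ∀ e, ¬ p (e % 5) → coeff e f = 0

lemma Supp.mul {p r s : ℕ → Prop} {f h : (ZMod 5)⟦X⟧} (hf : Supp p f) (hh : Supp r h)
    (H : ∀ a b, p (a % 5) → r (b % 5) → s ((a + b) % 5)) : Supp s (f * h) := by
  intro e he
  rw [coeff_mul]
  apply sum_eq_zero
  rintro ⟨a, b⟩ hab
  have hab : a + b = e := by simpa using hab
  by_cases h1 : p (a % 5)
  · by_cases h2 : r (b % 5)
    · exact absurd (hab ▸ H a b h1 h2) he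
    · rw [hh b h2, mul_zero]
  · rw [hf a h1, zero_mul]

lemma supp_pow (f : (ZMod 5)⟦X⟧) : Supp (· = 0) (f ^ 5) := by
  intro e he
  have h : PowerSeries.map (frobenius (ZMod 5) 5) (PowerSeries.expand 5 (by norm_num) f) = f ^ 5 :=
    MvPowerSeries.map_frobenius_expand 5 (by norm_num) (f := f)
  rw [← h, coeff_map, coeff_expand_of_not_dvd _ _ _ (by omega), map_zero]

/-- generating function of partitions -/
noncomputable def G : (ZMod 5)⟦X⟧ := PowerSeries.mk fun n => (Fintype.card (Nat.Partition n) : ZMod 5)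

open scoped PowerSeries.WithPiTopology in
lemma G_mul : G * φ = 1 := by
  let _ : TopologicalSpace (ZMod 5) := ⊥
  have : DiscreteTopology (ZMod 5) := ⟨rfl⟩
  have h1 := Nat.Partition.hasProd_powerSeriesMk_card_restricted (ZMod 5) (fun _ => True)
  have h2 := WithPiTopology.hasProd_one_sub_X_pow (ZMod 5)
  have h3 := h1.mul h2
  have e : (PowerSeries.mk fun n => (#(Nat.Partition.restricted n (fun _ => True)) : ZMod 5)) = G := by
    unfold G Nat.Partition.restricted
    simp [Finset.card_univ]
  rw [e] at h3
  refine h3.unique ?_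
  convert hasProd_one with i
  simp only [if_true, pow_mul]
  exact WithPiTopology.tsum_pow_mul_one_sub_of_constantCoeff_eq_zero (by simp)

lemma ram (n : ℕ) (hn : n % 5 = 4) : 5 ∣ Fintype.card (Nat.Partition n) := by
  have h3 : Supp (fun r => r = 0 ∨ r = 1) (φ ^ 3) := by
    intro e he
    push Not at he
    exact coeff_φ_cube e he.1 he.2
  have h6 : Supp (fun r => r ≤ 2) (φ ^ 3 * φ ^ 3) := h3.mul h3 (by omega)
  have h9 : Supp (fun r => r ≤ 3) (φ ^ 3 * φ ^ 3 * φ ^ 3) := h6.mul h3 (by omega)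
  have hG : Supp (fun r => r ≤ 3) (φ ^ 3 * φ ^ 3 * φ ^ 3 * (G ^ 2) ^ 5) :=
    h9.mul (supp_pow _) (by omega)
  have e : φ ^ 3 * φ ^ 3 * φ ^ 3 * (G ^ 2) ^ 5 = G := by
    calc _ = (G * φ) ^ 9 * G := by ring
      _ = G := by rw [G_mul]; simp
  rw [e] at hG
  have := hG n (by omega)
  rw [G, coeff_mk] at this
  exact (ZMod.natCast_eq_zero_iff _ _).1 this

end Ram
namespace Ram
open Finset

/-- rotation of colours in blocks of five, on odd parts -/
def rot (p : ℕ × ℕ) : ℕ × ℕ :=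
  if Even p.1 then p else (p.1, if p.2 % 5 = 0 then p.2 - 4 else p.2 + 1)

lemma rot_fst (p : ℕ × ℕ) : (rot p).1 = p.1 := by unfold rot; split_ifs <;> rfl

lemma rot_even {p : ℕ × ℕ} (h : Even p.1) : rot p = p := by simp [rot, h]

lemma rot_five (p : ℕ × ℕ) (h : 1 ≤ p.2) : rot (rot (rot (rot (rot p)))) = p := by
  obtain ⟨m, c⟩ := p
  by_cases hm : Even m
  · simp [rot, hm]
  · simp only [rot, hm, if_false, Prod.mk.injEq, true_and]
    simp only at h
    split_ifs <;> omega

/-- weight of a part -/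
def w (r : ℕ) (p : ℕ × ℕ) : ℕ := if ¬ Even p.1 ∧ p.2 % 5 = r then p.1 else 0

lemma w_rot (r : ℕ) (hr : r < 5) (p : ℕ × ℕ) (h : 1 ≤ p.2) : w ((r + 1) % 5) (rot p) = w r p := by
  obtain ⟨m, c⟩ := p
  by_cases hm : Even m
  · simp [rot, hm, w]
  · simp only [rot, hm, if_false, w, not_false_eq_true, true_and]
    simp only at h
    split_ifs <;> omega

lemma odd_sum_dvd (s : Multiset (ℕ × ℕ)) (hs : ∀ p ∈ s, 1 ≤ p.2) (hfix : s.map rot = s) :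
    5 ∣ ((s.filter (fun p => ¬ Even p.1)).map Prod.fst).sum := by
  have h : ∀ r < 5, (s.map (w ((r + 1) % 5))).sum = (s.map (w r)).sum := by
    intro r hr
    conv_lhs => rw [← hfix, Multiset.map_map]
    congr 1
    exact Multiset.map_congr rfl fun p hp => w_rot r hr p (hs p hp)
  have tot : ((s.filter (fun p => ¬ Even p.1)).map Prod.fst).sum =
      (s.map (w 0)).sum + (s.map (w 1)).sum + (s.map (w 2)).sum + (s.map (w 3)).sum
        + (s.map (w 4)).sum := by
    clear h hfix hs
    induction s using Multiset.induction with
    | empty => simp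
    | cons p s ih =>
      simp only [Multiset.map_cons, Multiset.sum_cons]
      by_cases hp : Even p.1
      · rw [Multiset.filter_cons_of_neg _ (by simpa using hp), ih]
        simp [w, hp]
      · rw [Multiset.filter_cons_of_pos _ (by simpa using hp), Multiset.map_cons,
          Multiset.sum_cons, ih]
        have : p.1 = w 0 p + w 1 p + w 2 p + w 3 p + w 4 p := by
          simp only [w, hp, not_false_eq_true, true_and]
          split_ifs <;> omega
        omega
  have h0 : (s.map (w 1)).sum = (s.map (w 0)).sum := h 0 (by norm_num)
  have h1 : (s.map (w 2)).sum = (s.map (w 1)).sum := h 1 (by norm_num)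
  have h2 : (s.map (w 3)).sum = (s.map (w 2)).sum := h 2 (by norm_num)
  have h3 : (s.map (w 4)).sum = (s.map (w 3)).sum := h 3 (by norm_num)
  omega

lemma filter_rot (s : Multiset (ℕ × ℕ)) (hfix : s.map rot = s) :
    (s.filter (fun p => ¬ Even p.1)).map rot = s.filter (fun p => ¬ Even p.1) := by
  conv_rhs => rw [← hfix, Multiset.filter_map]
  congr 1
  apply Multiset.filter_congr
  intro p _
  simp [rot_fst]

lemma fixed_card (k n : ℕ) (hk : 1 ≤ k) (F : Finset (Multiset (ℕ × ℕ)))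
    (hF : ∀ s, s ∈ F ↔ s ∈ coloredOddPartitions k (5 * n + 3) ∧ s.map rot = s) : 5 ∣ F.card := by
  classical
  rw [card_eq_sum_card_image (fun s => s.filter (fun p => ¬ Even p.1)) F]
  apply dvd_sum
  intro t ht
  obtain ⟨s0, hs0, rfl⟩ := mem_image.1 ht
  obtain ⟨⟨hp0, hsum0⟩, hfix0⟩ := (hF s0).1 hs0
  have hd0 := odd_sum_dvd s0 (fun p hp => (hp0 p hp).2.1) hfix0
  have hft := filter_rot s0 hfix0
  have hmem : ∀ p ∈ s0.filter (fun p => ¬ Even p.1), p ∈ s0 ∧ ¬ Even p.1 := by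
    intro p hp; simpa using hp
  set t := s0.filter (fun p => ¬ Even p.1) with ht
  -- halves of the even parts
  have halves : ∀ s : Multiset (ℕ × ℕ), (s.map Prod.fst).sum = 5 * n + 3 →
      s.filter (fun p => ¬ Even p.1) = t →
      2 * ((s.filter (fun p => Even p.1)).map (fun p => p.1 / 2)).sum + (t.map Prod.fst).sum
        = 5 * n + 3 := by
    intro s hs hst
    rw [← Multiset.sum_map_mul_left, ← hst]
    have : (s.filter (fun p => Even p.1)).map (fun p => 2 * (p.1 / 2)) =
        (s.filter (fun p => Even p.1)).map Prod.fst := by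
      apply Multiset.map_congr rfl
      intro p hp
      exact Nat.mul_div_cancel' (Multiset.mem_filter.1 hp).2.two_dvd
    rw [this, ← Multiset.sum_add, ← Multiset.map_add, Multiset.filter_add_not, hs]
  have h0 := halves s0 hsum0 ht.symm
  set N := ((s0.filter (fun p => Even p.1)).map (fun p => p.1 / 2)).sum with hN
  have hN4 : N % 5 = 4 := by omega
  have inj : Function.Injective (fun p : Nat.Partition N => t + p.parts.map (fun m => (2 * m, 1))) := by
    intro p q hpq
    have h1 := add_left_cancel hpq
    have : Function.Injective (fun m : ℕ => (2 * m, 1)) := by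
      intro a b hab
      simpa using hab
    exact Nat.Partition.ext (Multiset.map_injective this h1)
  have himg : F.filter (fun s => s.filter (fun p => ¬ Even p.1) = t) =
      (univ : Finset (Nat.Partition N)).image (fun p => t + p.parts.map (fun m => (2 * m, 1))) := by
    ext s
    rw [mem_filter, mem_image, hF]
    constructor
    · rintro ⟨⟨⟨hp, hsum⟩, hfix⟩, hst⟩
      have h1 := halves s hsum hst
      refine ⟨⟨(s.filter (fun p => Even p.1)).map (fun p => p.1 / 2), ?_, by omega⟩, mem_univ _, ?_⟩
      · intro i hi
        obtain ⟨p, hps, rfl⟩ := Multiset.mem_map.1 hi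
        obtain ⟨hps, hev⟩ := Multiset.mem_filter.1 hps
        have := (hp p hps).1
        have := hev.two_dvd
        omega
      · simp only [Multiset.map_map]
        have : (s.filter (fun p => Even p.1)).map ((fun m => (2 * m, 1)) ∘ fun p : ℕ × ℕ => p.1 / 2) =
            (s.filter (fun p => Even p.1)).map id := by
          apply Multiset.map_congr rfl
          intro p hps
          obtain ⟨hps, hev⟩ := Multiset.mem_filter.1 hps
          have := (hp p hps).2.2.2 hev
          have h2 := hev.two_dvd
          ext
          · simp only [Function.comp, id]; omega
          · simp [this]
        rw [this, Multiset.map_id, ← hst, add_comm, Multiset.filter_add_not]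
    · rintro ⟨p, -, rfl⟩
      refine ⟨⟨⟨?_, ?_⟩, ?_⟩, ?_⟩
      · intro x hx
        rcases Multiset.mem_add.1 hx with hx | hx
        · exact hp0 x (hmem x hx).1
        · obtain ⟨m, hm, rfl⟩ := Multiset.mem_map.1 hx
          have := p.parts_pos hm
          exact ⟨by simp only; omega, le_rfl, hk, fun _ => rfl⟩
      · rw [Multiset.map_add, Multiset.sum_add, Multiset.map_map]
        have : (p.parts.map (Prod.fst ∘ fun m => (2 * m, 1))).sum = 2 * N := by
          change (p.parts.map (fun m => 2 * m)).sum = _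
          rw [Multiset.sum_map_mul_left, Multiset.map_id', p.parts_sum]
        omega
      · rw [Multiset.map_add, hft, Multiset.map_map]
        congr 1
        apply Multiset.map_congr rfl
        intro m _
        exact rot_even (by simp)
      · rw [Multiset.filter_add, Multiset.filter_eq_self.2 (fun x hx => (hmem x hx).2),
          Multiset.filter_eq_nil.2, add_zero]
        intro x hx
        obtain ⟨m, hm, rfl⟩ := Multiset.mem_map.1 hx
        simp
  rw [himg, card_image_of_injective _ inj, card_univ]
  exact ram N hN4

lemma rot_mem (j N : ℕ) (s : Multiset (ℕ × ℕ)) (hs : s ∈ coloredOddPartitions (5 * j + 5) N) :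
    s.map rot ∈ coloredOddPartitions (5 * j + 5) N := by
  refine ⟨?_, ?_⟩
  · intro x hx
    obtain ⟨p, hp, rfl⟩ := Multiset.mem_map.1 hx
    obtain ⟨h1, h2, h3, h4⟩ := hs.1 p hp
    by_cases he : Even p.1
    · rw [rot_even he]; exact ⟨h1, h2, h3, h4⟩
    · refine ⟨by rwa [rot_fst], ?_, ?_, fun h => absurd (by rwa [rot_fst] at h) he⟩
      · simp only [rot, he, if_false]; split_ifs <;> omega
      · simp only [rot, he, if_false]; split_ifs <;> omega
  · rw [Multiset.map_map, ← hs.2]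
    congr 1
    exact Multiset.map_congr rfl fun p _ => rot_fst p

end Ram

theorem stmt2 (j n : ℕ) : a (5 * j + 5) (5 * n + 3) ≡ 0 [MOD 5] := by
  classical
  unfold a
  rcases finite_or_infinite (coloredOddPartitions (5 * j + 5) (5 * n + 3)) with hfin | hinf
  swap
  · rw [Nat.card_eq_zero_of_infinite]
  have := Fintype.ofFinite (coloredOddPartitions (5 * j + 5) (5 * n + 3))
  have : Fact (Nat.Prime 5) := ⟨by norm_num⟩
  let f : Function.End (coloredOddPartitions (5 * j + 5) (5 * n + 3)) :=
    fun s => ⟨s.1.map Ram.rot, Ram.rot_mem j _ s.1 s.2⟩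
  have hf : f ^ 5 ^ 1 = 1 := by
    funext s
    have : (f ^ 5 ^ 1) s = f (f (f (f (f s)))) := rfl
    rw [this]
    apply Subtype.ext
    change ((((s.1.map Ram.rot).map Ram.rot).map Ram.rot).map Ram.rot).map Ram.rot = s.1
    simp only [Multiset.map_map]
    conv_rhs => rw [← Multiset.map_id s.1]
    apply Multiset.map_congr rfl
    intro p hp
    exact Ram.rot_five p (s.2.1 p hp).2.1
  have h := Equiv.Perm.card_fixedPoints_modEq hf
  rw [Nat.card_eq_fintype_card]
  refine h.trans ((Nat.modEq_zero_iff_dvd).2 ?_)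
  let e : Function.fixedPoints f ↪ Multiset (ℕ × ℕ) :=
    ⟨fun s => s.1.1, fun x y hxy => Subtype.ext (Subtype.ext hxy)⟩
  have hc : Fintype.card (Function.fixedPoints f) = (Finset.univ.map e).card := by
    rw [Finset.card_map, Finset.card_univ]
  rw [hc]
  apply Ram.fixed_card (5 * j + 5) n (by omega)
  intro s
  rw [Finset.mem_map]
  constructor
  · rintro ⟨x, -, rfl⟩
    exact ⟨x.1.2, congrArg Subtype.val x.2⟩
  · rintro ⟨hs, hfix⟩
    exact ⟨⟨⟨s, hs⟩, Subtype.ext hfix⟩, Finset.mem_univ _, rfl⟩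
end

section
/- For every integer t with 0 ≤ t ≤ 8 and all integers n ≥ 0, a_{3t+2}(27n + 18 + t) ≡ 0 (mod 3). -/
open PowerSeries

abbrev PS := PowerSeries (ZMod 3)

/-- Gaussian binomial coefficients. -/
def qb {R : Type*} [CommRing R] (Q : R) : ℕ → ℕ → R
  | _, 0 => 1
  | 0, _ + 1 => 0
  | n + 1, k + 1 => qb Q n k + Q ^ (k + 1) * qb Q n (k + 1)

/-- q-factorial `(Q;Q)_n`. -/
def qf {R : Type*} [CommRing R] (Q : R) (n : ℕ) : R := ∏ i ∈ Finset.range n, (1 - Q ^ (i + 1))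

lemma qf_succ {R : Type*} [CommRing R] (Q : R) (n : ℕ) : qf Q (n+1) = qf Q n * (1 - Q^(n+1)) := by
  simp [qf, Finset.prod_range_succ]

lemma qb_zero_right {R : Type*} [CommRing R] (Q : R) (n : ℕ) : qb Q n 0 = 1 := by
  cases n <;> rfl

lemma qb_gt {R : Type*} [CommRing R] (Q : R) (n : ℕ) : ∀ k, n < k → qb Q n k = 0 := by
  induction n with
  | zero => intro k hk; cases k with
    | zero => omega
    | succ k => rfl
  | succ n ih => intro k hk; cases k with
    | zero => omega
    | succ k => simp [qb, ih k (by omega), ih (k+1) (by omega)]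

lemma qb_mul {R : Type*} [CommRing R] (Q : R) (n : ℕ) :
    ∀ k m, k + m = n → qb Q n k * qf Q k * qf Q m = qf Q n := by
  induction n with
  | zero =>
    intro k m h
    obtain rfl : k = 0 := by omega
    obtain rfl : m = 0 := by omega
    simp [qb, qf]
  | succ n ih =>
    intro k m h
    cases k with
    | zero =>
      obtain rfl : m = n + 1 := by omega
      simp [qb, qf]
    | succ k =>
      cases m with
      | zero =>
        obtain rfl : k = n := by omega
        have := ih k 0 rfl
        rw [qb, qb_gt Q k (k+1) (by omega), qf_succ]
        linear_combination (1 - Q^(k+1)) * this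
      | succ m =>
        have h1 := ih k (m+1) (by omega)
        have h2 := ih (k+1) m (by omega)
        have e : Q^(n+1) = Q^(k+1) * Q^(m+1) := by rw [← pow_add]; congr 1; omega
        rw [qb, qf_succ Q n, e]
        rw [qf_succ Q m] at h1 ⊢
        rw [qf_succ Q k] at h2 ⊢
        linear_combination (1 - Q^(k+1)) * h1 + Q^(k+1) * (1 - Q^(m+1)) * h2

lemma qbinom {R : Type*} [CommRing R] (Q y : R) (n : ℕ) : ∀ x : R,
    ∏ i ∈ Finset.range n, (y + x * Q ^ i) =
      ∑ k ∈ Finset.range (n+1), Q ^ (k.choose 2) * qb Q n k * x ^ k * y ^ (n - k) := by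
  induction n with
  | zero => intro x; simp [qb]
  | succ n ih =>
    intro x
    have h1 : ∏ i ∈ Finset.range n, (y + x * Q ^ (i+1)) =
        ∏ i ∈ Finset.range n, (y + (x * Q) * Q ^ i) := by
      apply Finset.prod_congr rfl; intros; ring
    rw [Finset.prod_range_succ', h1, ih]
    have h2 : ∀ T : ℕ → R, (∑ k ∈ Finset.range (n+1), T k) * y
        = ∑ k ∈ Finset.range (n+2), (if k ≤ n then T k * y else 0) := by
      intro T
      rw [Finset.sum_range_succ _ (n+1), if_neg (by omega), add_zero, Finset.sum_mul]
      apply Finset.sum_congr rfl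
      intro k hk
      rw [if_pos (by simp at hk; omega)]
    rw [pow_zero, mul_one, mul_add, h2, Finset.sum_range_succ' _ (n+1),
      Finset.sum_range_succ' _ (n+1)]
    rw [add_right_comm, Finset.sum_mul, ← Finset.sum_add_distrib]
    congr 1
    · apply Finset.sum_congr rfl
      intro k hk
      simp only [Finset.mem_range] at hk
      have hc : (k+1).choose 2 = k + k.choose 2 := by
        rw [Nat.choose_succ_succ' k 1]; simp
      rw [qb, hc]
      have hs : n + 1 - (k+1) = n - k := by omega
      rw [hs]
      split_ifs with h
      · have : n - k = (n - (k+1)) + 1 := by omega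
        rw [this]; ring
      · rw [qb_gt Q n (k+1) (by omega)]
        ring
    · simp [qb_zero_right]; ring

/-- Truncated theta sum. -/
noncomputable def S (r r' M : ℕ) : PS :=
  ∑ j ∈ Finset.range (M+1), (-1)^j * X ^ ((r+r') * j.choose 2 + r * j) +
  ∑ j ∈ Finset.range M, (-1)^(j+1) * X ^ ((r+r') * (j+1).choose 2 + r' * (j+1))

noncomputable def P (r r' M : ℕ) : PS :=
  ∏ i ∈ Finset.range M, ((1 - X ^ (r + (r+r') * i)) * (1 - X ^ (r' + (r+r') * i)))

lemma choose2 (j : ℕ) : 2 * j.choose 2 + j = j * j := by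
  induction j with
  | zero => rfl
  | succ k ih => rw [Nat.choose_succ_succ' k 1]; simp; nlinarith

lemma fjtp (r r' M : ℕ) : P r r' M =
    ∑ j ∈ Finset.range (M+1), (-1)^j * X ^ ((r+r') * j.choose 2 + r * j)
      * qb (X ^ (r+r') : PS) (2*M) (M+j) +
    ∑ j ∈ Finset.range M, (-1)^(j+1) * X ^ ((r+r') * (j+1).choose 2 + r' * (j+1))
      * qb (X ^ (r+r') : PS) (2*M) (M-(j+1)) := by
  set s := r + r' with hs
  have key := qbinom (X ^ s : PS) (X ^ (s*M)) (2*M) (- X^r)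
  have hE : ((-1)^M * X ^ (s*M*M + r*M + s * M.choose 2) : PS) ≠ 0 := by
    apply mul_ne_zero
    · exact pow_ne_zero _ (by simp)
    · exact pow_ne_zero _ X_ne_zero
  apply mul_left_cancel₀ hE
  trans ∏ i ∈ Finset.range (2*M), ((X:PS) ^ (s*M) + (- X^r) * (X^s) ^ i)
  · rw [two_mul, Finset.prod_range_add, P, Finset.prod_mul_distrib, ← hs]
    have a1 : ∏ i ∈ Finset.range M, ((X:PS) ^ (s*M) + (- X^r) * (X^s) ^ i)
        = (-1)^M * X ^ (r*M + s * M.choose 2) * ∏ i ∈ Finset.range M, (1 - X ^ (r' + s * i)) := by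
      have b1 : ∏ i ∈ Finset.range M, (1 - (X:PS) ^ (r' + s * i)) =
          ∏ i ∈ Finset.range M, (1 - (X:PS) ^ (r' + s * (M - 1 - i))) :=
        (Finset.prod_range_reflect (fun i => (1 - (X:PS) ^ (r' + s * i))) M).symm
      have b2 : ((-1)^M * X ^ (r*M + s * M.choose 2) : PS) =
          ∏ i ∈ Finset.range M, (- X ^ (r + s * i)) := by
        clear b1 hE key
        induction M with
        | zero => simp
        | succ M ih =>
          rw [Finset.prod_range_succ, ← ih, Nat.choose_succ_succ' M 1, Nat.choose_one_right]
          ring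
      rw [b1, b2, ← Finset.prod_mul_distrib]
      apply Finset.prod_congr rfl
      intro i hi
      simp only [Finset.mem_range] at hi
      obtain ⟨c, rfl⟩ : ∃ c, M = i + 1 + c := ⟨M - (i+1), by omega⟩
      have : i + 1 + c - 1 - i = c := by omega
      rw [this, hs]; ring
    have a2 : ∏ i ∈ Finset.range M, ((X:PS) ^ (s*M) + (- X^r) * (X^s) ^ (M+i))
        = X ^ (s*M*M) * ∏ i ∈ Finset.range M, (1 - X ^ (r + s * i)) := by
      have : (X:PS) ^ (s*M*M) = ∏ i ∈ Finset.range M, (X:PS)^(s*M) := by simp [pow_mul]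
      rw [this, ← Finset.prod_mul_distrib]
      apply Finset.prod_congr rfl
      intro i hi
      ring
    rw [a1, a2]; ring
  · rw [key]
    have : 2 * M + 1 = M + (M+1) := by ring
    rw [this, Finset.sum_range_add, add_comm, mul_add]
    congr 1
    · rw [Finset.mul_sum]
      apply Finset.sum_congr rfl
      intro j hj
      simp only [Finset.mem_range] at hj
      obtain ⟨c, rfl⟩ : ∃ c, M = j + c := ⟨M - j, by omega⟩
      have e : 2 * (j+c) - (j+c+j) = c := by omega
      rw [e]
      have h1 := choose2 (j+c)
      have h2 := choose2 j
      have h3 := choose2 (j+c+j)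
      rw [neg_pow ((X:PS)^r), ← pow_mul, ← pow_mul, ← pow_mul]
      have hx : s * (j + c + j).choose 2 + r * (j+c+j) + s * (j+c) * c =
        s * (j+c)*(j+c) + r*(j+c) + s * (j+c).choose 2 + (s * j.choose 2 + r * j) := by
        have : (j+c+j).choose 2 + (j+c)*c = (j+c)*(j+c) + (j+c).choose 2 + j.choose 2 := by nlinarith
        linear_combination s * this
      have hx' := congrArg (fun e => (X:PS)^e) hx
      simp only [pow_add _ _ (s * (j+c) * c), pow_add _ _ (r * (j+c+j)),
        pow_add _ _ (s * j.choose 2 + r * j)] at hx'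
      rw [pow_add (-1) (j+c) j]
      linear_combination ((-1)^(j+c) * (-1)^j * qb (X^s : PS) (2*(j+c)) (j+c+j)) * hx'
    · rw [Finset.mul_sum, ← Finset.sum_range_reflect]
      apply Finset.sum_congr rfl
      intro j hj
      simp only [Finset.mem_range] at hj
      obtain ⟨c, rfl⟩ : ∃ c, M = c + (j + 1) := ⟨M - (j+1), by omega⟩
      have e : c + (j+1) - 1 - j = c := by omega
      have e2 : c + (j+1) - (j+1) = c := by omega
      have e3 : 2 * (c + (j+1)) - c = c + 2 * (j+1) := by omega
      rw [e, e2, e3]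
      generalize j + 1 = l
      have h1 := choose2 (c+l)
      have h2 := choose2 l
      have h3 := choose2 c
      rw [neg_pow ((X:PS)^r), ← pow_mul, ← pow_mul, ← pow_mul]
      have hx : s * c.choose 2 + r * c + s * (c + l) * (c + 2*l) =
        s * (c+l)*(c+l) + r*(c+l) + s * (c+l).choose 2 + (s * l.choose 2 + r' * l) := by
        have : c.choose 2 + (c+l)*(c+2*l) = (c+l)*(c+l) + (c+l).choose 2 + l.choose 2 + l := by
          nlinarith
        linear_combination s * this + l * hs
      have hx' := congrArg (fun e => (X:PS)^e) hx
      simp only [pow_add _ _ (s * (c+l) * (c+2*l)), pow_add _ _ (r * c),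
        pow_add _ _ (s * l.choose 2 + r' * l)] at hx'
      have hm : (-1:PS)^(c+l) * (-1)^l = (-1)^c := by
        rw [pow_add, mul_assoc, ← mul_pow]; simp
      rw [← hm]
      linear_combination ((-1)^(c+l) * (-1)^l * qb (X^s : PS) (2*(c+l)) c) * hx'


lemma three_zero : (3 : PS) = 0 := by
  have h : (3 : ZMod 3) = 0 := by decide
  have h2 := congrArg (PowerSeries.C (R := ZMod 3)) h
  rwa [map_ofNat, map_zero] at h2

lemma cube_add (x y : PS) : (x + y)^3 = x^3 + y^3 := by
  linear_combination (x^2*y+x*y^2) * three_zero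

lemma S_succ (r r' M : ℕ) : S r r' (M+1) = S r r' M +
    (-1)^(M+1) * (X ^ ((r+r') * (M+1).choose 2 + r * (M+1))
      + X ^ ((r+r') * (M+1).choose 2 + r' * (M+1))) := by
  have h2 := Finset.sum_range_succ
    (fun j => (-1:PS)^(j+1) * X ^ ((r+r') * (j+1).choose 2 + r' * (j+1))) M
  rw [S, Finset.sum_range_succ _ (M+1), h2, S]; ring

lemma S11_succ (M : ℕ) : S 1 1 (M+1) = S 1 1 M + (-1)^(M+1) * (2 * X ^ ((M+1)*(M+1))) := by
  rw [S_succ, ← choose2 (M+1)]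
  norm_num; ring

lemma S15_succ (M : ℕ) : S 1 5 (M+1) = S 1 5 M +
    (-1)^(M+1) * (X ^ (3*M*M+4*M+1) + X ^ (3*M*M+8*M+5)) := by
  have h := choose2 (M+1)
  rw [S_succ]
  congr 4 <;> nlinarith

lemma dissect (M : ℕ) : S 1 1 (3*M+1) = S 1 1 M ^ 9 + X * S 1 5 M ^ 3 := by
  have h3 := three_zero
  induction M with
  | zero =>
    simp [S, Finset.sum_range_succ]
    linear_combination (-X) * h3
  | succ M ih =>
    have e : 3 * (M+1) + 1 = 3*M+1+1+1+1 := by ring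
    have h9 : ∀ x y : PS, (x+y)^9 = x^9+y^9 := by
      intro x y
      have : ∀ z : PS, z^9 = (z^3)^3 := by intro z; ring
      rw [this, cube_add, cube_add, ← this, ← this]
    have hm : ∀ n : ℕ, ((-1:PS)^n)^3 = (-1)^n := by
      intro n; rw [← pow_mul, mul_comm, pow_mul]; norm_num
    have hm9 : ∀ n : ℕ, ((-1:PS)^n)^9 = (-1)^n := by
      intro n; rw [← pow_mul, mul_comm, pow_mul]; norm_num
    have hm3 : ((-1:PS)^(3*M)) = (-1)^M := by
      rw [pow_mul]; norm_num
    rw [e, S11_succ (3*M+1+1+1), S11_succ (3*M+1+1), S11_succ (3*M+1), ih, S11_succ, S15_succ,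
      h9, cube_add, mul_pow, mul_pow, mul_pow,
      hm, hm9, cube_add, ← pow_mul, ← pow_mul, ← pow_mul]
    simp only [pow_succ (-1:PS), hm3]
    have e1 : (3*M+1+1)*(3*M+1+1) = (3*M*M+4*M+1)*3+1 := by ring
    have e2 : (3*M+1+1+1)*(3*M+1+1+1) = (M+1)*(M+1)*9 := by ring
    have e3 : (3*M+1+1+1+1)*(3*M+1+1+1+1) = (3*M*M+8*M+5)*3+1 := by ring
    rw [e1, e2, e3]
    generalize (X:PS)^((M+1)*(M+1)*9) = u
    rw [pow_succ (X:PS) ((3*M*M+4*M+1)*3), pow_succ (X:PS) ((3*M*M+8*M+5)*3)]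
    generalize (X:PS)^((3*M*M+4*M+1)*3) = v
    generalize (X:PS)^((3*M*M+8*M+5)*3) = w
    linear_combination ((-1)^M * (v * X + 170 * u + w * X)) * h3

/-- Reduction modulo `X^M`. -/
noncomputable def rd (M : ℕ) : PS →+* PS ⧸ Ideal.span {(X : PS)^M} := Ideal.Quotient.mk _

lemma rd_eq (M : ℕ) (x y : PS) : rd M x = rd M y ↔ (X:PS)^M ∣ x - y := by
  rw [rd, Ideal.Quotient.mk_eq_mk_iff_sub_mem, Ideal.mem_span_singleton]

lemma rd_mono {L M : ℕ} (h : L ≤ M) {x y : PS} (hx : rd M x = rd M y) : rd L x = rd L y := by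
  rw [rd_eq] at *
  exact (pow_dvd_pow _ h).trans hx

lemma eq_of_rd {x y : PS} (h : ∀ M, rd M x = rd M y) : x = y := by
  ext n
  have := (rd_eq _ _ _).1 (h (n+1))
  rw [X_pow_dvd_iff] at this
  have := this n (by omega)
  rw [map_sub] at this
  exact sub_eq_zero.1 this

lemma lim_exists (u : ℕ → PS) (h : ∀ M, rd M (u (M+1)) = rd M (u M)) :
    ∃ v, ∀ M, rd M v = rd M (u M) := by
  have hc : ∀ m d, coeff m (u (m+1+d)) = coeff m (u (m+1)) := by
    intro m d
    induction d with
    | zero => rfl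
    | succ d ih =>
      rw [← ih]
      have := (X_pow_dvd_iff.1 ((rd_eq _ _ _).1 (h (m+1+d)))) m (by omega)
      rw [map_sub] at this
      exact sub_eq_zero.1 this
  refine ⟨PowerSeries.mk fun m => coeff m (u (m+1)), fun M => ?_⟩
  rw [rd_eq, X_pow_dvd_iff]
  intro m hm
  obtain ⟨d, rfl⟩ : ∃ d, M = m+1+d := ⟨M-(m+1), by omega⟩
  rw [map_sub, coeff_mk, hc, sub_self]

lemma jtp (r r' : ℕ) (hr : 1 ≤ r) (hr' : 1 ≤ r') (f g : PS) (hfg : f * g = 1)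
    (hf : ∀ M, rd M f = rd M (qf (X^(r+r')) M)) (M : ℕ) :
    rd M (f * P r r' M) = rd M (S r r' M) := by
  have hB : ∀ l k m, l ≤ k → l ≤ m → k + m = 2 * M →
      rd l (f * qb (X^(r+r')) (2*M) k) = rd l 1 := by
    intro l k m hk hm hkm
    have h := congrArg (rd l) (qb_mul (X^(r+r') : PS) (2*M) k m hkm)
    rw [map_mul, map_mul, ← rd_mono hk (hf k), ← rd_mono hm (hf m),
      ← rd_mono (by omega : l ≤ 2 * M) (hf (2*M)), ← map_mul, ← map_mul] at h
    have h2 := congrArg (· * rd l g) h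
    simp only [← map_mul] at h2
    rw [hfg] at h2
    rw [← h2]
    congr 1
    linear_combination (- f * qb (X^(r+r')) (2*M) k) * hfg
  have hT : ∀ j k m ex : ℕ, j ≤ M → M - j ≤ k → M - j ≤ m → k + m = 2 * M → j ≤ ex →
      ∀ c : PS, rd M (f * (c * X^ex * qb (X^(r+r')) (2*M) k)) = rd M (c * X^ex) := by
    intro j k m ex hj hk hm hkm hex c
    have h := (rd_eq _ _ _).1 (hB (M-j) k m hk hm hkm)
    rw [rd_eq]
    have e : f * (c * X^ex * qb (X^(r+r')) (2*M) k) - c * X^ex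
      = c * (X^ex * (f * qb (X^(r+r')) (2*M) k - 1)) := by ring
    rw [e]
    apply Dvd.dvd.mul_left
    have : (X:PS)^M = X^j * X^(M-j) := by rw [← pow_add]; congr 1; omega
    rw [this]
    exact mul_dvd_mul (pow_dvd_pow _ hex) h
  rw [fjtp, S, mul_add, Finset.mul_sum, Finset.mul_sum, map_add, map_add, map_sum, map_sum,
    map_sum, map_sum]
  congr 1
  · apply Finset.sum_congr rfl
    intro j hj
    simp only [Finset.mem_range] at hj
    exact hT j (M+j) (M-j) _ (by omega) (by omega) (by omega) (by omega) (by nlinarith) _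
  · apply Finset.sum_congr rfl
    intro j hj
    simp only [Finset.mem_range] at hj
    exact hT (j+1) (M-(j+1)) (M+(j+1)) _ (by omega) (by omega) (by omega) (by omega)
      (by nlinarith) _

noncomputable def En (M : ℕ) : PS := ∏ i ∈ Finset.range M, (1 - X ^ (2*i+1))

lemma P11 (M : ℕ) : P 1 1 M = En M ^ 2 := by
  rw [P, En, ← Finset.prod_pow]
  apply Finset.prod_congr rfl
  intro i _
  ring

lemma cube_sub (x y : PS) : (x - y)^3 = x^3 - y^3 := by
  linear_combination (-x^2*y+x*y^2) * three_zero

lemma P15 (M : ℕ) : P 1 5 M * En M ^ 3 = En (3*M) := by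
  induction M with
  | zero => simp [P, En]
  | succ M ih =>
    have e : 3 * (M+1) = 3*M+1+1+1 := by ring
    rw [e]
    simp only [P, En] at *
    rw [Finset.prod_range_succ, Finset.prod_range_succ, Finset.prod_range_succ,
      Finset.prod_range_succ, Finset.prod_range_succ, ← ih, mul_pow, cube_sub]
    ring

lemma qf6 (M : ℕ) : qf (X^(1+5) : PS) M = qf (X^(1+1) : PS) M ^ 3 := by
  rw [qf, qf, ← Finset.prod_pow]
  apply Finset.prod_congr rfl
  intro i _
  rw [cube_sub]
  ring

lemma limits : ∃ D d E e : PS, D * d = 1 ∧ E * e = 1 ∧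
    (∀ M, rd M D = rd M (qf (X^(1+1)) M)) ∧ (∀ M, rd M E = rd M (En M)) := by
  have dv : ∀ (M n : ℕ) (x : PS), M ≤ n → rd M (x * (1 - X^n)) = rd M x := by
    intro M n x h
    rw [rd_eq]
    have : x * (1 - X^n) - x = X^n * (-x) := by ring
    rw [this]
    exact Dvd.dvd.mul_right (pow_dvd_pow _ h) _
  obtain ⟨D, hD⟩ := lim_exists (qf (X^(1+1) : PS)) (by
    intro M
    rw [qf_succ, ← pow_mul]
    exact dv _ _ _ (by omega))
  obtain ⟨E, hE⟩ := lim_exists En (by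
    intro M
    rw [En, Finset.prod_range_succ]
    exact dv _ _ _ (by omega))
  have cu : ∀ x : PS, rd 1 x = rd 1 1 → ∃ y, x * y = 1 := by
    intro x h
    rw [rd_eq, X_pow_dvd_iff] at h
    have h := h 0 (by omega)
    have : constantCoeff x = 1 := by
      simp at h
      exact sub_eq_zero.1 h
    have hu : IsUnit x := by
      rw [PowerSeries.isUnit_iff_constantCoeff, this]; exact isUnit_one
    exact hu.exists_right_inv
  obtain ⟨d, hd⟩ := cu D (by
    rw [hD, qf_succ, ← pow_mul, dv _ _ _ (by omega)]; simp [qf])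
  obtain ⟨e, he⟩ := cu E (by
    rw [hE, En, Finset.prod_range_succ, dv _ _ _ (by omega)]; simp)
  exact ⟨D, d, E, e, hd, he, hD, hE⟩

lemma key_identity (D d E e : PS) (hd : D * d = 1) (he : E * e = 1)
    (hD : ∀ M, rd M D = rd M (qf (X^(1+1)) M)) (hE : ∀ M, rd M E = rd M (En M)) :
    D * E^2 = (D*E^2)^9 + X * (D^3 * e^2)^3 := by
  have h1 : ∀ M, rd M (D*E^2) = rd M (S 1 1 M) := by
    intro M
    rw [← jtp 1 1 (by omega) (by omega) D d hd hD M, P11, map_mul, map_mul, map_pow, map_pow, hE]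
  have h2 : ∀ M, rd M (D^3 * e^2) = rd M (S 1 5 M) := by
    intro M
    rw [← jtp 1 5 (by omega) (by omega) (D^3) (d^3) (by rw [← mul_pow, hd, one_pow])
      (by intro M; rw [qf6, map_pow, map_pow, hD]) M]
    have h := congrArg (rd M) (P15 M)
    rw [map_mul, map_pow, ← hE, ← rd_mono (by omega : M ≤ 3 * M) (hE (3*M))] at h
    have he' := congrArg (rd M) he
    simp only [map_mul, map_one, map_pow] at *
    have : rd M (P 1 5 M) = rd M e ^ 2 := by
      generalize rd M E = E at *
      generalize rd M e = e at *
      generalize rd M (P 1 5 M) = p at *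
      have h3 : (E * e)^3 = 1 := by rw [he']; ring
      linear_combination e^3 * h - p * h3 + e^2 * he'
    rw [this]
  apply eq_of_rd
  intro M
  rw [rd_mono (by omega : M ≤ 3 * M + 1) (h1 (3*M+1)), dissect]
  rw [map_add, map_add, map_mul (rd M) X, map_mul (rd M) X, map_pow _ (S 1 1 M),
    map_pow _ (S 1 5 M), map_pow _ (D*E^2), map_pow _ (D^3*e^2), h1, h2]

lemma coeff_cube (f : PS) (m : ℕ) : coeff m (f^3) = if 3 ∣ m then coeff (m/3) f else 0 := by
  have h1 : rd (m+1) f = rd (m+1) (trunc (m+1) f : Polynomial (ZMod 3)) := by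
    rw [rd_eq, X_pow_dvd_iff]
    intro k hk
    rw [map_sub, Polynomial.coeff_coe, coeff_trunc, if_pos hk, sub_self]
  have h2 : rd (m+1) (f^3) = rd (m+1) ((trunc (m+1) f : Polynomial (ZMod 3)) ^ 3 : PS) := by
    rw [map_pow, map_pow, h1]
  have h3 := X_pow_dvd_iff.1 ((rd_eq _ _ _).1 h2) m (by omega)
  rw [map_sub, sub_eq_zero] at h3
  rw [h3, ← Polynomial.coe_pow, Polynomial.coeff_coe, ← ZMod.expand_card,
    Polynomial.coeff_expand (by norm_num)]
  split_ifs with h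
  · rw [coeff_trunc, if_pos (by omega)]
  · rfl

lemma coeff_three (U V W : PS) (M : ℕ) :
    coeff (3*M) (U^3 + X * V^3 + X^2 * W^3) = coeff M U ∧
    coeff (3*M+1) (U^3 + X * V^3 + X^2 * W^3) = coeff M V ∧
    coeff (3*M+2) (U^3 + X * V^3 + X^2 * W^3) = coeff M W := by
  have hs : ∀ F : PS, X * F = X^1 * F := by intro F; rw [pow_one]
  simp only [map_add, hs, coeff_X_pow_mul', coeff_cube]
  refine ⟨?_, ?_, ?_⟩
  · rw [if_pos (by omega)]
    have : ¬ (3 ∣ 3*M-1 ∧ 1 ≤ 3 * M) := by omega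
    have : ¬ (3 ∣ 3*M-2 ∧ 2 ≤ 3 * M) := by omega
    split_ifs <;> first | omega | simp
  · rw [if_neg (by omega), if_pos (by omega), if_pos (by omega)]
    split_ifs <;> first | omega | simp
  · rw [if_neg (by omega), if_pos (by omega), if_neg (by omega), if_pos (by omega),
      if_pos (by omega)]
    simp

lemma final_coeff (φ φi e b : PS) (h : φ = φ^9 + X * b^3) (hi : φ * φi = 1)
    (hb : b * e = φ^3 * e^9) (t n : ℕ) (ht : t ≤ 8) :
    coeff (27*n+18+t) (φi * (e^t)^3) = 0 := by
  have step : ∀ r ≤ 2, ∃ G : PS, G * e^r = (φ^2 * (-e^3)^r)^3 ∧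
      ∀ (M : ℕ) (k : PS), coeff (3*M+r) (φi * k^3) = coeff M (G * φi * k) := by
    have hx : ∀ k : PS, φi * k^3 = (φ^6 * φi * k)^3 + X * (-φ^3*b * φi * k)^3
        + X^2 * (b^2 * φi * k)^3 := by
      intro k
      have e1 : φi * k^3 = φ^2 * (φi * k)^3 := by
        linear_combination (-φi * k^3) * (φ * φi + 1) * hi
      rw [e1]
      have e2 : φ^2 = (φ^9 + X * b^3)^2 := by rw [← h]
      rw [e2]
      linear_combination (φ^9 * X * b^3 * (φi * k)^3) * three_zero
    intro r hr
    interval_cases r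
    · exact ⟨φ^6, by ring, fun M k => by rw [hx]; exact (coeff_three _ _ _ M).1⟩
    · refine ⟨-φ^3*b, ?_, fun M k => by rw [hx]; exact (coeff_three _ _ _ M).2.1⟩
      linear_combination (-φ^3) * hb
    · refine ⟨b^2, ?_, fun M k => by rw [hx]; exact (coeff_three _ _ _ M).2.2⟩
      linear_combination (b * e + φ^3*e^9) * hb
  obtain ⟨s, r, hs, hr, rfl⟩ : ∃ s r, s ≤ 2 ∧ r ≤ 2 ∧ t = 3*s+r :=
    ⟨t/3, t%3, by omega, by omega, by omega⟩
  obtain ⟨G, hG, hGc⟩ := step r hr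
  obtain ⟨G', hG', hGc'⟩ := step s hs
  have i1 : 27*n+18+(3*s+r) = 3 * (3*(3*n+2)+s) + r := by ring
  rw [i1, hGc]
  have i2 : G * φi * e^(3*s+r) = φi * (φ^2 * (-e^3)^r * e^s)^3 := by
    rw [pow_add, mul_comm 3 s, pow_mul]
    rw [mul_pow _ (e^s), ← hG]; ring
  rw [i2, hGc']
  have i3 : G' * φi * (φ^2 * (-e^3)^r * e^s) = φ * (φ^2 * (-e^3)^s * (-e)^r)^3 := by
    have c : ((-e)^r)^3 = (-e^3)^r := by rw [← pow_mul, mul_comm, pow_mul]; congr 1; ring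
    rw [mul_pow _ ((-e)^r), c, ← hG']
    linear_combination (G' * φ * (-e^3)^r * e^s) * hi
  rw [i3]
  generalize φ^2 * (-e^3)^s * (-e)^r = c
  have i4 : φ * c^3 = (φ^3 * c)^3 + X * (b * c)^3 + X^2 * 0^3 := by
    conv_lhs => rw [h]
    ring
  rw [i4, (coeff_three _ _ _ n).2.2]
  simp

/-- Multisets with entries in `T` and total weight `n`. -/
def cS (T : Finset (ℕ × ℕ)) (n : ℕ) : Set (Multiset (ℕ × ℕ)) :=
  {s | (∀ p ∈ s, p ∈ T) ∧ (s.map Prod.fst).sum = n}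

lemma cS_insert_lt (T : Finset (ℕ × ℕ)) (p : ℕ × ℕ) (n : ℕ) (h : n < p.1) :
    cS (insert p T) n = cS T n := by
  ext s
  simp only [cS, Set.mem_ofPred_eq]
  constructor
  · rintro ⟨h1, h2⟩
    refine ⟨fun q hq => ?_, h2⟩
    rcases Finset.mem_insert.1 (h1 q hq) with rfl | h'
    · have := Multiset.le_sum_of_mem (Multiset.mem_map_of_mem Prod.fst hq)
      omega
    · exact h'
  · rintro ⟨h1, h2⟩
    exact ⟨fun q hq => Finset.mem_insert_of_mem (h1 q hq), h2⟩

lemma cS_insert_ge (T : Finset (ℕ × ℕ)) (p : ℕ × ℕ) (m : ℕ) :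
    cS (insert p T) (m + p.1) = cS T (m + p.1) ∪ (fun s => p ::ₘ s) '' cS (insert p T) m := by
  ext s
  simp only [cS, Set.mem_ofPred_eq, Set.mem_union, Set.mem_image]
  constructor
  · rintro ⟨h1, h2⟩
    by_cases hp : p ∈ s
    · right
      obtain ⟨u, rfl⟩ := Multiset.exists_cons_of_mem hp
      refine ⟨u, ⟨fun q hq => h1 q (Multiset.mem_cons_of_mem hq), ?_⟩, rfl⟩
      simp at h2
      omega
    · left
      refine ⟨fun q hq => ?_, h2⟩
      rcases Finset.mem_insert.1 (h1 q hq) with rfl | h'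
      · exact absurd hq hp
      · exact h'
  · rintro (⟨h1, h2⟩ | ⟨u, ⟨h1, h2⟩, rfl⟩)
    · exact ⟨fun q hq => Finset.mem_insert_of_mem (h1 q hq), h2⟩
    · refine ⟨fun q hq => ?_, ?_⟩
      · rcases Multiset.mem_cons.1 hq with rfl | h'
        · exact Finset.mem_insert_self _ _
        · exact h1 q h'
      · simp [h2]; omega

lemma cS_empty (n : ℕ) : cS ∅ n = if n = 0 then {0} else ∅ := by
  ext s
  simp only [cS, Set.mem_ofPred_eq]
  constructor
  · rintro ⟨h1, h2⟩
    have : s = 0 := Multiset.eq_zero_of_forall_notMem (fun p hp => by simpa using h1 p hp)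
    subst this
    simp at h2
    simp [← h2]
  · intro h
    split_ifs at h with h0
    · simp at h; subst h; simp [h0]
    · simp at h

lemma cS_finite (T : Finset (ℕ × ℕ)) (hT : ∀ p ∈ T, 0 < p.1) : ∀ n, (cS T n).Finite := by
  induction T using Finset.induction_on with
  | empty => intro n; rw [cS_empty]; split_ifs <;> simp
  | insert p T hp ih =>
    have ih := ih (fun q hq => hT q (Finset.mem_insert_of_mem hq))
    have h0 := hT p (Finset.mem_insert_self _ _)
    intro n
    induction n using Nat.strong_induction_on with
    | _ n ihn =>
      rcases lt_or_ge n p.1 with h | h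
      · rw [cS_insert_lt _ _ _ h]; exact ih n
      · obtain ⟨m, rfl⟩ : ∃ m, n = m + p.1 := ⟨n - p.1, by omega⟩
        rw [cS_insert_ge]
        exact (ih _).union ((ihn m (by omega)).image _)

lemma cS_card (T : Finset (ℕ × ℕ)) (p : ℕ × ℕ) (hp : p ∉ T)
    (hT : ∀ q ∈ insert p T, 0 < q.1) (m : ℕ) :
    (cS (insert p T) (m + p.1)).ncard = (cS T (m + p.1)).ncard + (cS (insert p T) m).ncard := by
  have hinj : Function.Injective (fun s : Multiset (ℕ × ℕ) => p ::ₘ s) := by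
    intro u v h
    simpa using h
  rw [cS_insert_ge, Set.ncard_union_eq ?_ ?_ ?_, Set.ncard_image_of_injective _ hinj]
  · rw [Set.disjoint_left]
    rintro s ⟨h1, -⟩ ⟨u, -, rfl⟩
    exact hp (h1 p (Multiset.mem_cons_self _ _))
  · exact cS_finite T (fun q hq => hT q (Finset.mem_insert_of_mem hq)) _
  · exact (cS_finite _ hT _).image _

lemma cS_gen (T : Finset (ℕ × ℕ)) (hT : ∀ p ∈ T, 0 < p.1) :
    (PowerSeries.mk fun n => ((cS T n).ncard : ZMod 3)) * ∏ p ∈ T, (1 - (X:PS)^p.1) = 1 := by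
  induction T using Finset.induction_on with
  | empty =>
    rw [Finset.prod_empty, mul_one]
    ext n
    rw [coeff_mk, cS_empty, coeff_one]
    split_ifs <;> simp
  | insert p T hp ih =>
    have ih := ih (fun q hq => hT q (Finset.mem_insert_of_mem hq))
    rw [Finset.prod_insert hp, ← mul_assoc]
    refine Eq.trans ?_ ih
    congr 1
    ext n
    rw [mul_sub, mul_one, map_sub, coeff_mul_X_pow', coeff_mk, coeff_mk]
    split_ifs with h
    · obtain ⟨m, rfl⟩ : ∃ m, n = m + p.1 := ⟨n - p.1, by omega⟩
      rw [coeff_mk, cS_card T p hp hT, Nat.add_sub_cancel]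
      push_cast; ring
    · rw [cS_insert_lt _ _ _ (by omega), sub_zero, coeff_mk]

/-- Allowed colored parts up to twice `L`. -/
def TL (k L : ℕ) : Finset (ℕ × ℕ) :=
  (Finset.range L).image (fun i => (2*(i+1), 1)) ∪
  (Finset.range L ×ˢ Finset.range k).image (fun q => (2*q.1+1, q.2+1))

lemma TL_prod (k L : ℕ) : ∏ p ∈ TL k L, (1 - (X:PS)^p.1) = qf (X^(1+1)) L * En L ^ k := by
  rw [TL, Finset.prod_union, Finset.prod_image, Finset.prod_image, Finset.prod_product, qf, En,
    ← Finset.prod_pow]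
  · congr 1
    · apply Finset.prod_congr rfl
      intro i _
      rw [← pow_mul]
    · apply Finset.prod_congr rfl
      intro i _
      simp
  · rintro ⟨x, y⟩ _ ⟨z, w⟩ _ h
    simp at h
    ext <;> simp <;> omega
  · intro x _ y _ h
    simp at h
    omega
  · rw [Finset.disjoint_left]
    intro p hp hq
    simp only [Finset.mem_image] at hp hq
    obtain ⟨i, _, rfl⟩ := hp
    obtain ⟨j, _, h⟩ := hq
    simp at h
    omega

lemma TL_set (k L n : ℕ) (hk : 1 ≤ k) (hn : n ≤ 2*L) :
    coloredOddPartitions k n = cS (TL k L) n := by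
  ext s
  simp only [coloredOddPartitions, cS, Set.mem_ofPred_eq]
  refine and_congr_left (fun hs => forall₂_congr fun p hp => ?_)
  have hle : p.1 ≤ n := by
    rw [← hs]
    exact Multiset.le_sum_of_mem (Multiset.mem_map_of_mem Prod.fst hp)
  obtain ⟨m, c⟩ := p
  simp only [TL, Finset.mem_union, Finset.mem_image, Finset.mem_range, Finset.mem_product,
    Prod.exists, Prod.mk.injEq] at *
  constructor
  · rintro ⟨h1, h2, h3, h4⟩
    rcases Nat.even_or_odd m with h | h
    · left
      have := h4 h
      obtain ⟨j, rfl⟩ := h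
      exact ⟨j-1, by omega, by omega, by omega⟩
    · right
      obtain ⟨j, rfl⟩ := h
      exact ⟨j, c-1, by omega, by omega, by omega⟩
  · rintro (⟨i, h1, rfl, rfl⟩ | ⟨i, j, h1, rfl, rfl⟩)
    · exact ⟨by omega, by omega, by omega, fun _ => rfl⟩
    · refine ⟨by omega, by omega, by omega, fun h => ?_⟩
      obtain ⟨x, hx⟩ := h
      omega

lemma TL_pos (k L : ℕ) : ∀ p ∈ TL k L, 0 < p.1 := by
  intro p hp
  simp only [TL, Finset.mem_union, Finset.mem_image] at hp
  rcases hp with ⟨i, _, rfl⟩ | ⟨i, _, rfl⟩ <;> simp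

lemma a_gen (k : ℕ) (hk : 1 ≤ k) (D E : PS)
    (hD : ∀ M, rd M D = rd M (qf (X^(1+1)) M)) (hE : ∀ M, rd M E = rd M (En M)) :
    (PowerSeries.mk fun n => (a k n : ZMod 3)) * (D * E^k) = 1 := by
  apply eq_of_rd
  intro M
  rw [← cS_gen (TL k M) (TL_pos k M), TL_prod]
  simp only [map_mul, map_pow, hD, hE]
  congr 1
  rw [rd_eq, X_pow_dvd_iff]
  intro n hn
  rw [map_sub, coeff_mk, coeff_mk, a, TL_set k M n hk (by omega), Nat.card_coe_set_eq, sub_self]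

theorem stmt3 (t n : ℕ) (ht : t ≤ 8) :
    a (3 * t + 2) (27 * n + 18 + t) ≡ 0 [MOD 3] := by
  obtain ⟨D, d, E, e, hd, he, hD, hE⟩ := limits
  have hkey := key_identity D d E e hd he hD hE
  have hg := a_gen (3*t+2) (by omega) D E hD hE
  have he2 : E^2 * e^2 = 1 := by rw [← mul_pow, he, one_pow]
  have hi : (D*E^2) * (d * e^2) = 1 := by
    linear_combination (E^2*e^2) * hd + he2
  have hb : (D^3*e^2) * e = (D*E^2)^3 * e^9 := by
    have : E^6 * e^6 = 1 := by rw [← mul_pow, he, one_pow]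
    linear_combination (-D^3*e^3) * this
  have hz := final_coeff (D*E^2) (d*e^2) e (D^3*e^2) hkey hi hb t n ht
  have hF : (PowerSeries.mk fun n => (a (3*t+2) n : ZMod 3)) = (d*e^2) * (e^t)^3 := by
    have h3 : E^(3*t) * (e^t)^3 = 1 := by
      rw [← pow_mul, mul_comm t 3, ← mul_pow, he, one_pow]
    generalize (PowerSeries.mk fun n => (a (3*t+2) n : ZMod 3)) = F at *
    rw [pow_add] at hg
    linear_combination ((d*e^2) * (e^t)^3) * hg - F * hi - (F * ((D*E^2) * (d * e^2))) * h3
  rw [← hF, coeff_mk] at hz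
  rw [Nat.modEq_zero_iff_dvd]
  exact (ZMod.natCast_eq_zero_iff _ _).1 hz
end
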